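/- arXiv:1409.8649 — 5 statements merged into one kernel-verified Lean document; each statement's English description precedes it below -/
import Mathlib

section
/- Let σ > 0, β > 0 and 0 < ρ < (β + 1)(β/σ + 1). Then every solution u : [0, ∞) → ℝ³ of the Lorenz system with parameters (σ, ρ, β) whose range is bounded tends to the stationary set as t → +∞: dist(u(t), E) → 0, where E is the set of equilibria of the Lorenz system. -/
open Filter Topology

/-- Right-hand side of the Lorenz system with parameters `σ ρ β`:
`ẋ = σ(y − x), ẏ = ρx − y − xz, ż = −βz + xy`. -/
def lorenzRHS (σ ρ β : ℝ) (p : ℝ × ℝ × ℝ) : ℝ × ℝ × ℝ :=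
  (σ * (p.2.1 - p.1), ρ * p.1 - p.2.1 - p.1 * p.2.2, -β * p.2.2 + p.1 * p.2.1)

open MvPolynomial (mkDerivation eval pderiv)

theorem cubic_bound_of_mem_box {y μ y0 y1 m0 m1 : ℝ} (h0 : y0 ≤ y) (h1 : y ≤ y1)
    (h2 : m0 ≤ μ) (h3 : μ ≤ m1)
    (hb : (y0, y1, m0, m1) = (0, 1/2, 0, 3/8) ∨ (y0, y1, m0, m1) = (1/8, 1/2, 3/8, 3/4) ∨
      (y0, y1, m0, m1) = (0, 1/8, 3/8, 3/5)) :
    (2 * (1/2 + y) - 2/5 - μ - (59/40 + 3/10 * (1/2 + y)) * (1/2 + y - μ)) *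
      ((2 * (1/2 + y) - 2/5) * (12/5 - (1/2 + y)) - (2 + (1/2 + y)) * μ) ≤
      μ^2 * (59/40 + 3/10 * (1/2 + y)) * (1/2 + y - μ) := by
  have a0 := sub_nonneg.2 h0
  have a1 := sub_nonneg.2 h1
  have a2 := sub_nonneg.2 h2
  have a3 := sub_nonneg.2 h3
  have H : ∀ i j k l : ℕ, 0 ≤ (y-y0)^i*(y1-y)^j*((μ-m0)^k*(m1-μ)^l) :=
    fun i j k l => by positivity
  rcases hb with h | h | h <;>
  ( simp only [Prod.mk.injEq] at h
    obtain ⟨rfl, rfl, rfl, rfl⟩ := h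
    linarith [H 4 0 3 0, H 4 0 2 1, H 4 0 1 2, H 4 0 0 3, H 3 1 3 0, H 3 1 2 1, H 3 1 1 2,
      H 3 1 0 3, H 2 2 3 0, H 2 2 2 1, H 2 2 1 2, H 2 2 0 3, H 1 3 3 0, H 1 3 2 1, H 1 3 1 2,
      H 1 3 0 3, H 0 4 3 0, H 0 4 2 1, H 0 4 1 2, H 0 4 0 3])

/-- The numerical conditions on the coordinate parameters `η`, `a` and the weight `θ` under which
the compound quadratic form contracts. -/
structure IsAdmissible (s τ η a θ : ℝ) : Prop where
  a_pos : 0 < a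
  θ_pos : 0 < θ
  D2_pos : 0 < 1 + η
  D3_pos : 0 < 1 + s - η
  G_lt : (1 + η) * (1 + s - η) < s * (2 + s)
  mean : (1 + τ - 2 * a)^2 * a * (1 + s) ≤
    τ * (4 * ((1 + η) * (1 + s - η)) * (1 + τ - 2 * a) * a - 2 * θ * (τ - 1/2 + a - a * η)^2)
  square : (1 + s) * a * (2 * s * (3/2 - 2 * a)^2 + 2 * (τ - 1/2) * a * θ) ≤
    (s - τ + 1/2) * (4 * ((1 + η) * (1 + s - η)) * (1 + τ - 2 * a) * a
      - 2 * θ * (τ - 1/2 + a - a * η)^2)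
  schur : ∀ μ, (2 + s) * μ ≤ (1 + η) * (1 + s - η) →
    (1 + η - μ - θ * (s - μ)) * ((1 + η) * (1 + s - η) - (2 + s) * μ) ≤ μ^2 * θ * (s - μ)

theorem isAdmissible_of_one_le {s τ : ℝ} (hτ : 1 ≤ τ) (hs : τ ≤ s) :
    IsAdmissible s τ (τ - 1) (9/20) 1 := by
  obtain ⟨y, rfl⟩ : ∃ y, τ = 1 + y := ⟨τ - 1, by ring⟩
  obtain ⟨t, rfl⟩ : ∃ t, s = 1 + y + t := ⟨s - (1 + y), by ring⟩
  have hy : 0 ≤ y := by linarith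
  have ht : 0 ≤ t := by linarith
  have hG : (1 + (1 + y - 1)) * (1 + (1 + y + t) - (1 + y - 1)) <
      (1 + y + t) * (2 + (1 + y + t)) := by
    rw [← sub_pos]; ring_nf; positivity
  refine ⟨by norm_num, by norm_num, by linarith, by linarith, hG, ?_, ?_, ?_⟩
  · rw [← sub_nonneg]; ring_nf; positivity
  · rw [← sub_nonneg]; ring_nf; positivity
  · intro μ hμ
    have hμs : 0 < (1 + y + t) - μ := by
      by_contra! h
      nlinarith
    have : (1 + (1 + y - 1) - μ - 1 * (1 + y + t - μ)) ≤ 0 := by linarith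
    have h3 := mul_nonneg (sq_nonneg μ) hμs.le
    nlinarith [mul_nonneg (neg_nonneg.2 this) (sub_nonneg.2 hμ)]

theorem mean_condition_of_lt_one {y t : ℝ} (hy : 0 ≤ y) (ht : 0 ≤ t) (hz : 0 ≤ 1/2 - y)
    {τ s a θ M G : ℝ} (hτ : τ = 1/2 + y) (hs : s = τ + t) (ha : a = τ/2 - 3/40)
    (hθ : θ = 59/40 + 3/10 * τ) (hM : M = τ - 1/2 + a * (12/5 - 2 * τ))
    (hG : G = (2 * τ - 2/5) * (12/5 + s - 2 * τ)) :
    (23/20)^2 * a * (1 + s) ≤ τ * (4 * G * (23/20) * a - 2 * θ * M^2) := by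
  rw [← sub_nonneg]; subst hs hG hM hθ ha hτ
  nlinarith [mul_nonneg hy hz, mul_nonneg ht hy, mul_nonneg ht hz,
    mul_nonneg ht (mul_nonneg hy hz), mul_nonneg hy (mul_nonneg hy hz),
    mul_nonneg hy (mul_nonneg hy (mul_nonneg hy hz)), pow_nonneg hy 2, pow_nonneg hy 3,
    pow_nonneg hy 4, mul_nonneg ht (pow_nonneg hy 2), mul_nonneg ht (pow_nonneg hy 3)]

theorem square_condition_of_lt_one {y t : ℝ} (hy : 0 ≤ y) (ht : 0 ≤ t) (hz : 0 ≤ 1/2 - y)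
    {τ s a θ M G : ℝ} (hτ : τ = 1/2 + y) (hs : s = τ + t) (ha : a = τ/2 - 3/40)
    (hθ : θ = 59/40 + 3/10 * τ) (hM : M = τ - 1/2 + a * (12/5 - 2 * τ))
    (hG : G = (2 * τ - 2/5) * (12/5 + s - 2 * τ)) :
    (1 + s) * a * (2 * s * (33/20 - τ)^2 + 2 * (τ - 1/2) * a * θ) ≤
      (s - τ + 1/2) * (4 * G * (23/20) * a - 2 * θ * M^2) := by
  have c2 : 0 ≤ 131/20*y^2+989/400*y+161/8000-y^3 := by nlinarith [pow_nonneg hy 2]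
  have c1 : 0 ≤ 2179/500*y^3+112007/20000*y^2+1957463/800000*y+6139/160000-189/50*y^4
      -3/5*y^5 := by
    nlinarith [pow_nonneg hy 2, pow_nonneg hy 3, mul_nonneg (pow_nonneg hy 3) hz,
      mul_nonneg (pow_nonneg hy 4) hz]
  have c0 : 0 ≤ 3771/1600*y^3-80697/160000*y^2+68613/1600000*y+4529/320000-803/400*y^4
      -29/20*y^5 := by
    linarith [pow_nonneg hy 5, pow_nonneg hz 5, mul_nonneg (pow_nonneg hy 4) hz,
      mul_nonneg (pow_nonneg hz 4) hy, mul_nonneg (pow_nonneg hy 3) (pow_nonneg hz 2),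
      mul_nonneg (pow_nonneg hy 2) (pow_nonneg hz 3)]
  rw [← sub_nonneg]; subst hs hG hM hθ ha hτ
  linarith [mul_nonneg ht c1, mul_nonneg (pow_nonneg ht 2) c2]

theorem schur_base_of_lt_one {y μ : ℝ} (hy : 0 ≤ y) (hz : y ≤ 1/2) (hμ : 0 ≤ μ)
    (hμ' : μ ≤ 1/2 + y)
    (hk : 0 ≤ 2 * (1/2 + y) - 2/5 - μ - (59/40 + 3/10 * (1/2 + y)) * (1/2 + y - μ)) :
    (2 * (1/2 + y) - 2/5 - μ - (59/40 + 3/10 * (1/2 + y)) * (1/2 + y - μ)) *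
      ((2 * (1/2 + y) - 2/5) * (12/5 - (1/2 + y)) - (2 + (1/2 + y)) * μ) ≤
      μ^2 * (59/40 + 3/10 * (1/2 + y)) * (1/2 + y - μ) := by
  rcases le_or_gt ((2 * (1/2 + y) - 2/5) * (12/5 - (1/2 + y)) - (2 + (1/2 + y)) * μ) 0 with h | h
  · have h1 := sub_nonneg.2 hμ'
    have : 0 ≤ μ^2 * (59/40 + 3/10 * (1/2 + y)) * (1/2 + y - μ) := by positivity
    nlinarith [mul_nonneg hk (neg_nonneg.2 h)]
  rcases le_total μ (3/8) with h1 | h1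
  · exact cubic_bound_of_mem_box hy hz hμ h1 (Or.inl rfl)
  rcases le_total y (1/8) with h2 | h2
  · exact cubic_bound_of_mem_box hy h2 h1 (by nlinarith) (Or.inr (Or.inr rfl))
  · exact cubic_bound_of_mem_box h2 hz h1 (by nlinarith) (Or.inr (Or.inl rfl))

theorem schur_condition_of_lt_one {y t μ k E θ D2 : ℝ} (hy : 0 ≤ y) (hz : y ≤ 1/2) (ht : 0 ≤ t)
    (hμ : 0 ≤ μ) (hD2 : D2 = 2 * (1/2 + y) - 2/5) (hμ2 : μ ≤ D2)
    (hθ : θ = 59/40 + 3/10 * (1/2 + y))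
    (hk : k = D2 - μ - θ * (1/2 + y + t - μ))
    (hE : E = D2 * (12/5 - (1/2 + y) + t) - (2 + (1/2 + y + t)) * μ)
    (hk0 : 0 ≤ k) (hE0 : 0 ≤ E) :
    k * E ≤ μ^2 * θ * (1/2 + y + t - μ) := by
  have hθ1 : 1 ≤ θ := by linarith
  have hd := sub_nonneg.2 hμ2
  have hμ' : μ ≤ 1/2 + y := by
    by_contra! h
    have hst : 0 ≤ 1/2 + y + t - μ := by
      by_contra! h'
      nlinarith [mul_nonneg ht hy, mul_nonneg hy hy, mul_nonneg hd ht]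
    have h1 : t ≤ 1/10 + y := by nlinarith [mul_nonneg (sub_nonneg.2 hθ1) hst]
    have h2 : t * (D2 - μ) ≤ (1/10 + y) * (1/10 + y) :=
      mul_le_mul h1 (by linarith) hd (by linarith)
    nlinarith [sq_nonneg (y - 1/10)]
  have ek : k = 2 * (1/2 + y) - 2/5 - μ - θ * (1/2 + y - μ) - θ * t := by
    rw [hk, hD2]; ring
  have h0 := schur_base_of_lt_one hy hz hμ hμ' (by
    rw [← hθ]; nlinarith [mul_nonneg (zero_le_one.trans hθ1) ht])
  rw [← hθ] at h0
  have h1 : 0 ≤ t * ((D2 - μ) * (12/5 * θ - 2 * (1/2 + y) + 2/5 - (2 * θ - 1) * μ)) := by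
    refine mul_nonneg ht (mul_nonneg hd ?_)
    nlinarith
  have h2 : 0 ≤ t^2 * (θ * (D2 - μ)) := by positivity
  rw [hk, hE]
  rw [hD2] at h1 h2 ⊢
  linarith

theorem isAdmissible_of_lt_one {s τ : ℝ} (hτ : 1/2 < τ) (hτ1 : τ < 1) (hs : τ ≤ s) :
    IsAdmissible s τ (2 * τ - 7/5) (τ/2 - 3/40) (59/40 + 3/10 * τ) := by
  obtain ⟨y, rfl⟩ : ∃ y, τ = 1/2 + y := ⟨τ - 1/2, by ring⟩
  obtain ⟨t, rfl⟩ : ∃ t, s = 1/2 + y + t := ⟨s - (1/2 + y), by ring⟩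
  have hy : 0 ≤ y := by linarith
  have ht : 0 ≤ t := by linarith
  have hz : 0 ≤ 1/2 - y := by linarith
  have hG : (1 + (2 * (1/2 + y) - 7/5)) * (1 + (1/2 + y + t) - (2 * (1/2 + y) - 7/5)) <
      (1/2 + y + t) * (2 + (1/2 + y + t)) := by
    nlinarith [mul_nonneg hy hz, mul_nonneg ht hy, mul_nonneg ht hz]
  refine ⟨by linarith, by linarith, by linarith, by linarith, hG, ?_, ?_, ?_⟩
  · convert mean_condition_of_lt_one hy ht hz rfl rfl rfl rfl rfl rfl using 1 <;> ring
  · convert square_condition_of_lt_one hy ht hz rfl rfl rfl rfl rfl rfl using 1 <;> ring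
  · intro μ hμ
    have hμs : 0 ≤ (1/2 + y + t) - μ := by
      by_contra! h
      nlinarith
    have hE0 := sub_nonneg.2 hμ
    have hθ : 0 ≤ 59/40 + 3/10 * (1/2 + y) - 1 := by linarith
    have hr : 0 ≤ μ^2 * (59/40 + 3/10 * (1/2 + y)) * (1/2 + y + t - μ) := by positivity
    rcases le_or_gt (1 + (2 * (1/2 + y) - 7/5) - μ -
      (59/40 + 3/10 * (1/2 + y)) * (1/2 + y + t - μ)) 0 with h | hk0
    · nlinarith [mul_nonneg (neg_nonneg.2 h) hE0]
    have hμ0 : 0 ≤ μ := by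
      by_contra! h
      nlinarith [mul_nonneg hy hy, mul_nonneg ht hθ, mul_nonneg hθ (neg_nonneg.2 h.le)]
    refine schur_condition_of_lt_one hy (by linarith) ht hμ0 rfl ?_ rfl (by ring) (by ring)
      hk0.le hE0
    by_contra! h
    have : 0 < (2 + (1/2 + y + t)) * (μ - (2 * (1/2 + y) - 2/5)) :=
      mul_pos (by linarith) (by linarith)
    nlinarith [sq_nonneg (2 * (1/2 + y) - 2/5)]

theorem exists_isAdmissible {s τ : ℝ} (hτ : 1/2 < τ) (hs : τ ≤ s) :
    ∃ η a θ, IsAdmissible s τ η a θ := by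
  rcases le_or_gt 1 τ with h | h
  · exact ⟨_, _, _, isAdmissible_of_one_le h hs⟩
  · exact ⟨_, _, _, isAdmissible_of_lt_one hτ h hs⟩

theorem schur_psd {d1 d2 d3 o1 o2 e b c : ℝ} (h1 : 0 < d1) (h2 : 0 < d2)
    (h : o1^2 * d1 + 4 * o2^2 * d2 ≤ 4 * d1 * d2 * d3) :
    0 ≤ d1 * e^2 + d2 * b^2 + d3 * c^2 - o1 * (b * c) + 2 * o2 * (e * c) := by
  have key : 4 * d1 * d2 * (d1 * e^2 + d2 * b^2 + d3 * c^2 - o1 * (b * c) + 2 * o2 * (e * c)) =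
      4 * d2 * (d1 * e + o2 * c)^2 + d1 * (2 * d2 * b - o1 * c)^2 +
      (4 * d1 * d2 * d3 - (o1^2 * d1 + 4 * o2^2 * d2)) * c^2 := by ring
  have h3 : 0 ≤ 4 * d1 * d2 * (d1 * e^2 + d2 * b^2 + d3 * c^2 - o1 * (b * c) + 2 * o2 * (e * c)) := by
    rw [key]
    have := sub_nonneg.2 h
    positivity
  exact nonneg_of_mul_nonneg_right h3 (by positivity)

/-- Derivative along the flow of
`v₁ω + v₂xp + v₃ω² + v₄(p² + x⁴/4 + x²ω − rx²) + v₅x²`. -/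
noncomputable def potRate (s r κ v1 v2 v3 v4 v5 x p ω : ℝ) : ℝ :=
  v1 * (κ * x^2 - ω) + v2 * (p^2 - s * (x * p) + r * x^2 - x^4 / 2 - x^2 * ω) +
    2 * v3 * (κ * x^2 * ω - ω^2) + v4 * (-2 * s * p^2 + κ * x^4 - x^2 * ω) + 2 * v5 * (x * p)

theorem exists_potRate_le {s τ r η a θ : ℝ} (hτ : 1/2 < τ) (hs : τ < s) (hr : r < 1 + s)
    (H : IsAdmissible s τ η a θ) :
    ∃ u1 u2 u3 u4 u5, ∀ x p ω,
      potRate s r (τ - 1/2) u1 u2 u3 u4 u5 x p ω + 4 * ((1 + η) * (1 + s - η)) * (1 + s - r) ≤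
      4 * ((1 + η) * (1 + s - η)) * ((1 + η) * (1 + s - η) + (1 + s - r)) -
      (2 * ((1 + η) * (1 + s - η)) - ((3/2 - 2 * a) * x^2 + ω))^2 -
      θ * (2 / a) * ((τ - 1/2 + a - a * η) * x + a * p)^2 := by
  have ha := H.a_pos
  have hθ := H.θ_pos
  have hm := H.mean
  have hq := H.square
  set G := (1 + η) * (1 + s - η) with hG
  set M := τ - 1/2 + a - a * η with hM
  obtain ⟨κ, hκ⟩ : ∃ κ, κ = τ - 1/2 := ⟨_, rfl⟩
  rw [← hκ] at hq ⊢
  have hκ0 : 0 < κ := by linarith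
  have hs0 : 0 < s := by linarith
  set h := 3/2 - 2 * a with hh
  obtain ⟨u2, hu2⟩ : ∃ u2, u2 = (4 * G * (h + κ) - 2 * θ / a * M^2) / (1 + s) := ⟨_, rfl⟩
  have hu2' : (1 + s) * a * u2 = 4 * G * (h + κ) * a - 2 * θ * M^2 := by
    rw [hu2]; field_simp
  have hmh : 1 + τ - 2 * a = h + κ := by rw [hh, hκ]; ring
  rw [hmh] at hm hq
  rw [← hu2'] at hm hq
  have hpos : 0 < a * (1 + s) := by positivity
  have e1 : (h + κ)^2 ≤ τ * u2 := le_of_mul_le_mul_left (by linarith) hpos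
  have e2 : 2 * s * h^2 + 2 * κ * a * θ ≤ (s - κ) * u2 :=
    le_of_mul_le_mul_left (by rw [hκ]; rw [hκ] at hq; linarith) hpos
  have hu20 : 0 ≤ u2 := nonneg_of_mul_nonneg_right ((sq_nonneg _).trans e1) (by linarith)
  obtain ⟨u4, hu4⟩ : ∃ u4, u4 = (u2 + 2 * a * θ) / (2 * s) := ⟨_, rfl⟩
  have hu4' : 2 * s * u4 = u2 + 2 * a * θ := by rw [hu4]; field_simp
  obtain ⟨A, hA⟩ : ∃ A, A = u2 / 2 - h^2 - κ * u4 := ⟨_, rfl⟩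
  have hA0 : 0 ≤ A := by
    have : 0 ≤ 2 * s * A := by
      rw [hA]
      have : 2 * s * (u2 / 2 - h^2 - κ * u4) = s * u2 - 2 * s * h^2 - κ * (2 * s * u4) := by ring
      rw [this, hu4']
      linarith
    exact nonneg_of_mul_nonneg_right this (by positivity)
  obtain ⟨B, hB⟩ : ∃ B, B = u2 + u4 - 2 * h - κ := ⟨_, rfl⟩
  have hAB : κ * B + A = τ * u2 - (h + κ)^2 := by
    rw [hA, hB, show τ = κ + 1/2 by linarith]; ring
  have hAB0 : 0 ≤ κ * B + A := by rw [hAB]; linarith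
  obtain ⟨q, hq'⟩ : ∃ q, q = (κ * B + 2 * A) / κ^2 := ⟨_, rfl⟩
  refine ⟨-4 * G, u2, (1 + q) / 2, u4, (s * u2 - 4 * θ * M) / 2, fun x p ω => ?_⟩
  rw [← sub_nonneg]
  have key : 4 * G * (G + (1 + s - r)) - (2 * G - (h * x^2 + ω))^2 -
      θ * (2 / a) * (M * x + a * p)^2 - (potRate s r κ (-4 * G) u2 ((1 + q) / 2) u4
        ((s * u2 - 4 * θ * M) / 2) x p ω + 4 * G * (1 + s - r)) =
      u2 * (1 + s - r) * x^2 + A * (x^2 - ω / κ)^2 + (κ * B + A) * (ω / κ)^2 := by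
    have hx : 4 * G * (h + κ) = (1 + s) * u2 + 2 * θ / a * M^2 := by
      rw [hu2]; field_simp; ring
    have hx2 : θ * (2 / a) * (M * x + a * p)^2 =
        2 * θ / a * M^2 * x^2 + 4 * θ * M * (x * p) + 2 * θ * a * p^2 := by field_simp; ring
    have hqB : q * κ = B + 2 * A / κ := by rw [hq']; field_simp
    have hqA : (κ * B + A) * (ω / κ)^2 + A * (ω/κ)^2 = q * ω^2 := by rw [hq']; field_simp; ring
    have hA2 : A * (x^2 - ω / κ)^2 = A * x^4 - (2 * A / κ) * x^2 * ω + A * (ω/κ)^2 := by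
      ring
    rw [hx2, hA2]
    unfold potRate
    linear_combination x^2 * hx + p^2 * hu4' - hqA + (-x^2 * ω) * hqB - x^4 * hA + (-x^2*ω) * hB
  rw [key]
  have : 0 ≤ 1 + s - r := by linarith
  positivity

theorem potRate_smul (k s r κ v1 v2 v3 v4 v5 x p ω : ℝ) :
    potRate s r κ (k * v1) (k * v2) (k * v3) (k * v4) (k * v5) x p ω =
      k * potRate s r κ v1 v2 v3 v4 v5 x p ω := by
  unfold potRate; ring

theorem exists_compound_decay {s τ r η a θ : ℝ} (hτ : 1/2 < τ) (hs : τ < s) (hr : r < 1 + s)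
    (H : IsAdmissible s τ η a θ) :
    ∃ w v1 v2 v3 v4 v5 δ, 0 < w ∧ 0 < δ ∧ ∀ x p ω e b c,
      (potRate s r (τ - 1/2) v1 v2 v3 v4 v5 x p ω + δ) * (2 * a * w * e^2 + w * b^2 + c^2) ≤
      s * (2 * a * w * e^2) + (1 + η) * (w * b^2) + (1 + s - η) * c^2 -
      (w + r - (3/2 - 2 * a) * x^2 - ω + η * (s - η)) * (b * c) +
      2 * ((τ - 1/2 + a - a * η) * x + a * p) * (e * c) := by
  obtain ⟨u1, u2, u3, u4, u5, hu⟩ := exists_potRate_le hτ hs hr H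
  have ha := H.a_pos
  have hθ := H.θ_pos
  have hD2 := H.D2_pos
  have hD3 := H.D3_pos
  have hs0 : 0 < s := by linarith
  have hsch := H.schur
  have hGlt := H.G_lt
  obtain ⟨G, hG⟩ : ∃ G, G = (1 + η) * (1 + s - η) := ⟨_, rfl⟩
  have hG0 : 0 < G := by rw [hG]; positivity
  have hε : 0 < 1 + s - r := by linarith
  obtain ⟨w, hw⟩ : ∃ w, w = G + (1 + s - r) := ⟨_, rfl⟩
  have hw0 : 0 < w := by linarith
  rw [← hG] at hsch hGlt hu
  set k := 1 / (4 * (2 + s) * w) with hk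
  have hk0 : 0 < k := by positivity
  refine ⟨w, k * u1, k * u2, k * u3, k * u4, k * u5, k * (4 * G * (1 + s - r)), hw0,
    by positivity, fun x p ω e b c => ?_⟩
  rw [potRate_smul, ← mul_add]
  have hY := hu x p ω
  obtain ⟨μ, hμ⟩ : ∃ μ, μ = k * (potRate s r (τ - 1/2) u1 u2 u3 u4 u5 x p ω
    + 4 * G * (1 + s - r)) := ⟨_, rfl⟩
  rw [← hμ]
  obtain ⟨o1, ho1⟩ : ∃ o1, o1 = 2 * G - ((3/2 - 2 * a) * x^2 + ω) := ⟨_, rfl⟩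
  obtain ⟨o2, ho2⟩ : ∃ o2, o2 = (τ - 1/2 + a - a * η) * x + a * p := ⟨_, rfl⟩
  have eo1 : w + r - (3/2 - 2 * a) * x^2 - ω + η * (s - η) = o1 := by
    rw [ho1, hw, hG]; ring
  rw [eo1, ← ho2]
  rw [← ho1, ← ho2, ← hw] at hY
  have hkk : 4 * (2 + s) * w * k = 1 := by rw [hk]; field_simp
  have hμY : 4 * w * ((2 + s) * μ) ≤ 4 * G * w - o1^2 - θ * (2 / a) * o2^2 := by
    have : 4 * w * ((2 + s) * μ) = (4 * (2 + s) * w * k) *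
      (potRate s r (τ - 1/2) u1 u2 u3 u4 u5 x p ω + 4 * G * (1 + s - r)) := by rw [hμ]; ring
    rw [this, hkk]; linarith
  obtain ⟨A1, hA1⟩ : ∃ A1, A1 = o1^2 / (4 * w) := ⟨_, rfl⟩
  obtain ⟨A2, hA2⟩ : ∃ A2, A2 = o2^2 / (2 * a * w) := ⟨_, rfl⟩
  have hA10 : 0 ≤ A1 := by rw [hA1]; positivity
  have hA20 : 0 ≤ A2 := by rw [hA2]; positivity
  have eA1 : o1^2 = 4 * w * A1 := by rw [hA1]; field_simp
  have eA2 : o2^2 = 2 * a * w * A2 := by rw [hA2]; field_simp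
  have hZ : (2 + s) * μ ≤ G - A1 - θ * A2 := by
    have e : θ * (2 / a) * o2^2 = 4 * w * (θ * A2) := by rw [eA2]; field_simp; ring
    rw [eA1, e] at hμY
    refine le_of_mul_le_mul_left ?_ (show 0 < 4 * w by positivity)
    linarith
  have hθA : 0 ≤ θ * A2 := by positivity
  have hμG : (2 + s) * μ ≤ G := by linarith
  have h2s : 0 < 2 + s := by linarith
  have hμs : μ < s := lt_of_mul_lt_mul_left (a := 2 + s) (by linarith) h2s.le
  have hμ2 : μ < 1 + η := by
    refine lt_of_mul_lt_mul_left (a := 2 + s) ?_ h2s.le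
    rw [hG] at hμG
    nlinarith [mul_pos hD2 hD2]
  have hd1 : 0 < s - μ := by linarith
  have hd2 : 0 < 1 + η - μ := by linarith
  have hs1 := hsch μ hμG
  have main : A1 * (s - μ) + A2 * (1 + η - μ) ≤ (s - μ) * (1 + η - μ) * (1 + s - η - μ) := by
    have e : (1 + η - μ) * (1 + s - η - μ) = G - (2 + s) * μ + μ^2 := by rw [hG]; ring
    rw [mul_assoc, e]
    have h1 : A1 * (s - μ) ≤ (G - (2 + s) * μ - θ * A2) * (s - μ) :=
      mul_le_mul_of_nonneg_right (by linarith) hd1.le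
    rcases le_or_gt (1 + η - μ - θ * (s - μ)) 0 with h | h
    · have h2 := mul_nonpos_of_nonneg_of_nonpos hA20 h
      have h3 := mul_nonneg hd1.le (sq_nonneg μ)
      linarith
    · have h2 : θ * A2 * (1 + η - μ - θ * (s - μ)) ≤
          (G - (2 + s) * μ) * (1 + η - μ - θ * (s - μ)) :=
        mul_le_mul_of_nonneg_right (by linarith) h.le
      have h3 : A2 * (1 + η - μ - θ * (s - μ)) ≤ μ^2 * (s - μ) :=
        le_of_mul_le_mul_left (a := θ) (by linarith) hθ
      linarith
  have := schur_psd (d1 := 2 * a * w * (s - μ)) (d2 := w * (1 + η - μ)) (d3 := 1 + s - η - μ)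
    (o1 := o1) (o2 := o2) (e := e) (b := b) (c := c) (by positivity) (by positivity) (by
      rw [eA1, eA2]
      have := mul_le_mul_of_nonneg_left main (show 0 ≤ 8 * a * w^2 by positivity)
      linarith)
  linarith

/-- Coefficients of a normal form of the Lorenz vector field. -/
structure Coeffs (R : Type*) where
  (s r η a b e : R)

def Coeffs.map {R S : Type*} (f : R → S) (c : Coeffs R) : Coeffs S :=
  ⟨f c.s, f c.r, f c.η, f c.a, f c.b, f c.e⟩

def map3 {R S : Type*} (f : R → S) (q : R × R × R) : S × S × S := (f q.1, f q.2.1, f q.2.2)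

section Ring

variable {R : Type*} [CommRing R]

def vf (c : Coeffs R) (q : R × R × R) : R × R × R :=
  (q.2.1 - c.η * q.1,
    (c.η - c.s) * (q.2.1 - c.η * q.1) + q.1 * (c.r - c.b * q.1 ^ 2 - q.2.2),
    c.e * q.1 ^ 2 - q.2.2 + 2 * c.a * q.1 * q.2.1)

/-- The differential of `vf c` at `q`, applied to `ξ`. -/
def dvf (c : Coeffs R) (q ξ : R × R × R) : R × R × R :=
  (ξ.2.1 - c.η * ξ.1,
    (c.η - c.s) * (ξ.2.1 - c.η * ξ.1) + ξ.1 * (c.r - 3 * c.b * q.1 ^ 2 - q.2.2) - q.1 * ξ.2.2,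
    2 * c.e * q.1 * ξ.1 - ξ.2.2 + 2 * c.a * (ξ.1 * q.2.1 + q.1 * ξ.2.1))

def dot (u v : R × R × R) : R := u.1 * v.1 + u.2.1 * v.2.1 + u.2.2 * v.2.2

/-- One Euler step of length `h`. -/
def eulerStep (c : Coeffs R) (h : R) (q : R × R × R) : R × R × R := q + h • vf c q

/-- The tangent map of an Euler step. -/
def jetStep (c : Coeffs R) (h : R) (z : (R × R × R) × (R × R × R)) :
    (R × R × R) × (R × R × R) :=
  (eulerStep c h z.1, z.2 + h • dvf c z.1 z.2)

/-- The exterior derivative of the one-form `dot (vf c) ·`. -/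
def curl (c : Coeffs R) (q ξ ζ : R × R × R) : R :=
  dot (dvf c q ζ) ξ - dot (dvf c q ξ) ζ

theorem map3_vf {S : Type*} [CommRing S] (f : R →+* S) (c : Coeffs R) (q : R × R × R) :
    map3 f (vf c q) = vf (c.map f) (map3 f q) := by
  have h2 : f 2 = 2 := map_ofNat f 2
  simp [map3, vf, Coeffs.map, h2]

theorem map3_dvf {S : Type*} [CommRing S] (f : R →+* S) (c : Coeffs R) (q ξ : R × R × R) :
    map3 f (dvf c q ξ) = dvf (c.map f) (map3 f q) (map3 f ξ) := by
  have h2 : f 2 = 2 := map_ofNat f 2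
  have h3 : f 3 = 3 := map_ofNat f 3
  simp [map3, dvf, Coeffs.map, h2, h3]

theorem map_dot {S : Type*} [CommRing S] (f : R →+* S) (u v : R × R × R) :
    f (dot u v) = dot (map3 f u) (map3 f v) := by
  simp [map3, dot]

theorem map3_add_smul {S : Type*} [CommRing S] (f : R →+* S) (h : R) (u v : R × R × R) :
    map3 f (u + h • v) = map3 f u + f h • map3 f v := by
  simp [map3]

theorem map3_iterate_eulerStep {S : Type*} [CommRing S] (f : R →+* S) (c : Coeffs R) (h : R)
    (q : R × R × R) (n : ℕ) :
    map3 f ((eulerStep c h)^[n] q) = (eulerStep (c.map f) (f h))^[n] (map3 f q) := by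
  induction n with
  | zero => rfl
  | succ n ih =>
    rw [Function.iterate_succ_apply', Function.iterate_succ_apply', ← ih, eulerStep, eulerStep,
      map3_add_smul, map3_vf]

theorem jetStep_iterate_fst (c : Coeffs R) (h : R) (z : (R × R × R) × (R × R × R)) (n : ℕ) :
    ((jetStep c h)^[n] z).1 = (eulerStep c h)^[n] z.1 := by
  induction n with
  | zero => rfl
  | succ n ih => rw [Function.iterate_succ_apply', Function.iterate_succ_apply', ← ih]; rfl

theorem jetStep_iterate_zero (c : Coeffs R) (h : R) (q : R × R × R) (n : ℕ) :
    ((jetStep c h)^[n] (q, 0)).2 = 0 := by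
  induction n with
  | zero => rfl
  | succ n ih =>
    rw [Function.iterate_succ_apply', jetStep, ih]
    simp [dvf]

end Ring

section Derivation

variable {A : Type*} [CommRing A] [Algebra ℝ A]

theorem Derivation.map3_vf (D : Derivation ℝ A A) (c : Coeffs ℝ) (q : A × A × A) :
    map3 D (vf (c.map (algebraMap ℝ A)) q) = dvf (c.map (algebraMap ℝ A)) q (map3 D q) := by
  simp only [map3, vf, dvf, Coeffs.map, map_sub, map_add, Derivation.leibniz,
    Derivation.leibniz_pow, Derivation.map_algebraMap, smul_eq_mul, Prod.mk.injEq]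
  have h2 : D (2 : A) = 0 := by
    have := D.map_natCast 2
    simpa using this
  simp only [h2]
  refine ⟨by ring, ?_, ?_⟩ <;> simp <;> ring

theorem Derivation.map3_iterate_eulerStep (D : Derivation ℝ A A) (c : Coeffs ℝ) (h : ℝ)
    (q : A × A × A) (n : ℕ) :
    (jetStep (c.map (algebraMap ℝ A)) (algebraMap ℝ A h))^[n] (q, map3 D q) =
    ((eulerStep (c.map (algebraMap ℝ A)) (algebraMap ℝ A h))^[n] q,
      map3 D ((eulerStep (c.map (algebraMap ℝ A)) (algebraMap ℝ A h))^[n] q)) := by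
  induction n with
  | zero => rfl
  | succ n ih =>
    rw [Function.iterate_succ_apply', Function.iterate_succ_apply', ih]
    generalize (eulerStep (c.map (algebraMap ℝ A)) (algebraMap ℝ A h))^[n] q = y
    rw [jetStep]
    refine Prod.ext rfl ?_
    dsimp only
    rw [eulerStep, ← D.map3_vf]
    simp [map3]

theorem Derivation.closed_defect (D S : Derivation ℝ A A) (hDS : ∀ f, D (S f) = S (D f))
    (c : Coeffs ℝ) (Φ : A × A × A) (k : A)
    (hk : S k = dot (vf (c.map (algebraMap ℝ A)) Φ) (map3 S Φ)) :
    S (D k - dot (vf (c.map (algebraMap ℝ A)) Φ) (map3 D Φ)) =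
      curl (c.map (algebraMap ℝ A)) Φ (map3 S Φ) (map3 D Φ) := by
  rw [map_sub, ← hDS, hk, curl, ← D.map3_vf, ← S.map3_vf]
  simp only [dot, map3, map_add, Derivation.leibniz, smul_eq_mul, hDS]
  ring

end Derivation

theorem MvPolynomial.exists_pderiv_eq {ι : Type*} (i : ι) (f : MvPolynomial ι ℝ) :
    ∃ k, pderiv i k = f := by
  classical
  induction f using MvPolynomial.induction_on' with
  | monomial m c =>
    refine ⟨MvPolynomial.monomial (m + Finsupp.single i 1) (c / (m i + 1)), ?_⟩
    have : (m i : ℝ) + 1 ≠ 0 := by positivity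
    rw [MvPolynomial.pderiv_monomial]
    simp [this]
  | add p q hp hq =>
    obtain ⟨k, hk⟩ := hp
    obtain ⟨l, hl⟩ := hq
    exact ⟨k + l, by rw [map_add, hk, hl]⟩

theorem MvPolynomial.hasDerivAt_eval {ι : Type*} {γ : ℝ → ι → ℝ} {t : ℝ}
    (E : Derivation ℝ (MvPolynomial ι ℝ) (MvPolynomial ι ℝ))
    (h : ∀ i, HasDerivAt (fun t => γ t i) (eval (γ t) (E (MvPolynomial.X i))) t)
    (f : MvPolynomial ι ℝ) :
    HasDerivAt (fun t => eval (γ t) f) (eval (γ t) (E f)) t := by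
  induction f using MvPolynomial.induction_on with
  | C a => simpa using hasDerivAt_const t a
  | add p q hp hq =>
    simp only [map_add]
    exact hp.add hq
  | mul_X p i hp =>
    simp only [map_mul, MvPolynomial.eval_X, Derivation.leibniz, smul_eq_mul, map_add]
    exact (hp.mul (h i)).congr_deriv (by ring)

/-- The polynomial ring in a homotopy parameter and the three phase coordinates. -/
abbrev HPoly := MvPolynomial (Fin 4) ℝ

def hpt (σ : ℝ) (q : ℝ × ℝ × ℝ) : Fin 4 → ℝ := ![σ, q.1, q.2.1, q.2.2]

noncomputable def phase : HPoly × HPoly × HPoly :=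
  (MvPolynomial.X 1, MvPolynomial.X 2, MvPolynomial.X 3)

noncomputable def Coeffs.poly (c : Coeffs ℝ) : Coeffs HPoly := c.map (algebraMap ℝ HPoly)

/-- The derivation along the vector field `vf c`, killing the homotopy parameter. -/
noncomputable def flowD (c : Coeffs ℝ) : Derivation ℝ HPoly HPoly :=
  mkDerivation ℝ ![0, (vf c.poly phase).1, (vf c.poly phase).2.1, (vf c.poly phase).2.2]

/-- The derivation with respect to the homotopy parameter. -/
noncomputable def homD : Derivation ℝ HPoly HPoly := pderiv 0

theorem map3_flowD_phase (c : Coeffs ℝ) : map3 (flowD c) phase = vf c.poly phase := by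
  simp [map3, flowD, phase, MvPolynomial.mkDerivation_X]

theorem map3_homD_phase : map3 homD phase = 0 := by
  simp [map3, homD, phase, MvPolynomial.pderiv_X]

theorem homD_X_zero : homD (MvPolynomial.X 0) = 1 := by simp [homD]

theorem flowD_X_zero (c : Coeffs ℝ) : flowD c (MvPolynomial.X 0) = 0 := by
  simp [flowD, MvPolynomial.mkDerivation_X]

theorem flowD_homD_comm (c : Coeffs ℝ) (f : HPoly) : flowD c (homD f) = homD (flowD c f) := by
  have h1 : map3 homD (vf c.poly phase) = 0 := by
    rw [Coeffs.poly, Derivation.map3_vf, map3_homD_phase]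
    simp [dvf]
  rw [← map3_flowD_phase] at h1
  simp only [map3, phase, Prod.mk_eq_zero] at h1
  have h0 := map3_homD_phase
  simp only [map3, phase, Prod.mk_eq_zero] at h0
  have : ⁅flowD c, homD⁆ = 0 := by
    refine MvPolynomial.derivation_ext fun i => ?_
    rw [Derivation.commutator_apply]
    fin_cases i
    · simp [homD_X_zero, flowD_X_zero]
    · simp [h0, h1]
    · simp [h0, h1]
    · simp [h0, h1]
  have h2 := congrArg (fun E : Derivation ℝ HPoly HPoly => E f) this
  simp only [Derivation.commutator_apply, Derivation.zero_apply] at h2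
  exact sub_eq_zero.1 h2

theorem map3_eval_phase (σ : ℝ) (q : ℝ × ℝ × ℝ) : map3 (eval (hpt σ q)) phase = q := by
  simp [map3, phase, hpt]

theorem Coeffs.map_eval_poly (c : Coeffs ℝ) (v : Fin 4 → ℝ) : c.poly.map (eval v) = c := by
  simp [Coeffs.poly, Coeffs.map, MvPolynomial.algebraMap_eq]

theorem HasDerivAt.prod_fst {E F : Type*} [NormedAddCommGroup E] [NormedSpace ℝ E]
    [NormedAddCommGroup F] [NormedSpace ℝ F] {f : ℝ → E × F} {f' : E × F} {t : ℝ}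
    (h : HasDerivAt f f' t) : HasDerivAt (fun t => (f t).1) f'.1 t :=
  (ContinuousLinearMap.fst ℝ E F).hasFDerivAt.comp_hasDerivAt t h

theorem HasDerivAt.prod_snd {E F : Type*} [NormedAddCommGroup E] [NormedSpace ℝ E]
    [NormedAddCommGroup F] [NormedSpace ℝ F] {f : ℝ → E × F} {f' : E × F} {t : ℝ}
    (h : HasDerivAt f f' t) : HasDerivAt (fun t => (f t).2) f'.2 t :=
  (ContinuousLinearMap.snd ℝ E F).hasFDerivAt.comp_hasDerivAt t h

theorem hasDerivAt_eval_flowD (c : Coeffs ℝ) {U : ℝ → ℝ × ℝ × ℝ} {t : ℝ} (σ : ℝ)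
    (hU : HasDerivAt U (vf c (U t)) t) (f : HPoly) :
    HasDerivAt (fun t => eval (hpt σ (U t)) f) (eval (hpt σ (U t)) (flowD c f)) t := by
  have h1 := hU.prod_fst
  have h2 := hU.prod_snd.prod_fst
  have h3 := hU.prod_snd.prod_snd
  have e := map3_vf (eval (hpt σ (U t))) c.poly phase
  rw [c.map_eval_poly, map3_eval_phase, ← map3_flowD_phase] at e
  simp only [map3, phase, Prod.ext_iff] at e
  obtain ⟨e1, e2, e3⟩ := e
  refine MvPolynomial.hasDerivAt_eval (γ := fun t => hpt σ (U t)) (flowD c) (fun i => ?_) f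
  fin_cases i
  · simpa [flowD_X_zero, hpt] using hasDerivAt_const t σ
  · exact h1.congr_deriv e1.symm
  · exact h2.congr_deriv e2.symm
  · exact h3.congr_deriv e3.symm

theorem hasDerivAt_eval_homD (q : ℝ × ℝ × ℝ) (σ : ℝ) (f : HPoly) :
    HasDerivAt (fun σ => eval (hpt σ q) f) (eval (hpt σ q) (homD f)) σ := by
  have h0 := map3_homD_phase
  simp only [map3, phase, Prod.mk_eq_zero] at h0
  refine MvPolynomial.hasDerivAt_eval (γ := fun σ => hpt σ q) homD (fun i => ?_) f
  fin_cases i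
  · exact (hasDerivAt_id σ).congr_deriv (by simp [homD_X_zero])
  · simpa [h0, hpt] using hasDerivAt_const σ q.1
  · simpa [h0, hpt] using hasDerivAt_const σ q.2.1
  · simpa [h0, hpt] using hasDerivAt_const σ q.2.2

theorem eval_jetStep (c : Coeffs ℝ) (h : ℝ) (E : Derivation ℝ HPoly HPoly)
    (R : HPoly × HPoly × HPoly) (n : ℕ) (v : Fin 4 → ℝ) :
    (map3 (eval v) ((eulerStep c.poly (algebraMap ℝ HPoly h))^[n] R),
      map3 (eval v) (map3 E ((eulerStep c.poly (algebraMap ℝ HPoly h))^[n] R))) =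
    (jetStep c h)^[n] (map3 (eval v) R, map3 (eval v) (map3 E R)) := by
  have key : ∀ (m : ℕ) (z : (HPoly × HPoly × HPoly) × (HPoly × HPoly × HPoly)),
      Prod.map (map3 (eval v)) (map3 (eval v))
        ((jetStep c.poly (algebraMap ℝ HPoly h))^[m] z) =
      (jetStep c h)^[m] (Prod.map (map3 (eval v)) (map3 (eval v)) z) := by
    intro m z
    induction m with
    | zero => rfl
    | succ m ih =>
      rw [Function.iterate_succ_apply', Function.iterate_succ_apply', ← ih]
      simp only [jetStep, eulerStep, Prod.map, map3_add_smul, map3_vf, map3_dvf,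
        c.map_eval_poly, MvPolynomial.algebraMap_eq, MvPolynomial.eval_C]
  have h1 := key n (R, map3 E R)
  rw [Coeffs.poly, Derivation.map3_iterate_eulerStep] at h1
  exact h1

theorem exists_primitive (c : Coeffs ℝ) (h : ℝ) (n : ℕ) (R : HPoly × HPoly × HPoly) :
    ∃ k : HPoly, ∀ (q : ℝ × ℝ × ℝ) (K : ℝ) (y ξ ζ : ℝ → ℝ × ℝ × ℝ),
      (∀ σ, (y σ, ξ σ) = (jetStep c h)^[n]
        (map3 (eval (hpt σ q)) R, map3 (eval (hpt σ q)) (map3 homD R))) →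
      (∀ σ, (y σ, ζ σ) = (jetStep c h)^[n]
        (map3 (eval (hpt σ q)) R, map3 (eval (hpt σ q)) (map3 (flowD c) R))) →
      (∀ σ ∈ Set.Icc (0 : ℝ) 1, |curl c (y σ) (ξ σ) (ζ σ)| ≤ K) →
      |(eval (hpt 1 q) (flowD c k) - dot (vf c (y 1)) (ζ 1)) -
        (eval (hpt 0 q) (flowD c k) - dot (vf c (y 0)) (ζ 0))| ≤ K := by
  set Φ := (eulerStep c.poly (algebraMap ℝ HPoly h))^[n] R with hΦ
  obtain ⟨k, hk⟩ := MvPolynomial.exists_pderiv_eq 0 (dot (vf c.poly Φ) (map3 homD Φ))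
  refine ⟨k, fun q K y ξ ζ h1 h2 hK => ?_⟩
  have ey : ∀ σ, y σ = map3 (eval (hpt σ q)) Φ ∧
      ξ σ = map3 (eval (hpt σ q)) (map3 homD Φ) := fun σ => by
    have := h1 σ
    rw [← eval_jetStep] at this
    exact Prod.ext_iff.1 this
  have ez : ∀ σ, ζ σ = map3 (eval (hpt σ q)) (map3 (flowD c) Φ) := fun σ => by
    have := h2 σ
    rw [← eval_jetStep] at this
    exact (Prod.ext_iff.1 this).2
  have hm := Derivation.closed_defect (flowD c) homD (flowD_homD_comm c) c Φ k hk
  rw [← Coeffs.poly] at hm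
  set m := flowD c k - dot (vf c.poly Φ) (map3 (flowD c) Φ) with hm'
  have em : ∀ σ, eval (hpt σ q) m =
      eval (hpt σ q) (flowD c k) - dot (vf c (y σ)) (ζ σ) := fun σ => by
    rw [hm', map_sub, map_dot, map3_vf, c.map_eval_poly, (ey σ).1, ez σ]
  rw [← em, ← em]
  have hd : ∀ σ ∈ Set.Icc (0 : ℝ) 1, HasDerivWithinAt (fun σ => eval (hpt σ q) m)
      (curl c (y σ) (ξ σ) (ζ σ)) (Set.Icc 0 1) σ := fun σ _ => by
    have := (hasDerivAt_eval_homD q σ m).hasDerivWithinAt (s := Set.Icc 0 1)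
    rw [hm] at this
    refine this.congr_deriv ?_
    simp only [curl, map_sub, map_dot, map3_dvf, (ey σ).1, (ey σ).2, ez σ]
    rw [c.map_eval_poly]
  have := (convex_Icc (0 : ℝ) 1).norm_image_sub_le_of_norm_hasDerivWithin_le hd hK
    (Set.left_mem_Icc.2 zero_le_one) (Set.right_mem_Icc.2 zero_le_one)
  simpa using this

def ret1 (η κ σ : ℝ) (q : ℝ × ℝ × ℝ) : ℝ × ℝ × ℝ :=
  (q.1, η * q.1 + σ * (q.2.1 - η * q.1), κ * q.1 ^ 2 + σ * (q.2.2 - κ * q.1 ^ 2))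

def ret1S (η κ : ℝ) (q : ℝ × ℝ × ℝ) : ℝ × ℝ × ℝ :=
  (0, q.2.1 - η * q.1, q.2.2 - κ * q.1 ^ 2)

def ret1D (η κ σ : ℝ) (q f : ℝ × ℝ × ℝ) : ℝ × ℝ × ℝ :=
  (f.1, η * f.1 + σ * (f.2.1 - η * f.1),
    2 * κ * q.1 * f.1 + σ * (f.2.2 - 2 * κ * q.1 * f.1))

def ret2 (η κ σ : ℝ) (q : ℝ × ℝ × ℝ) : ℝ × ℝ × ℝ :=
  (σ * q.1, σ * (η * q.1), σ ^ 2 * (κ * q.1 ^ 2))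

def ret2S (η κ σ : ℝ) (q : ℝ × ℝ × ℝ) : ℝ × ℝ × ℝ :=
  (q.1, η * q.1, 2 * σ * (κ * q.1 ^ 2))

def ret2D (η κ σ : ℝ) (q f : ℝ × ℝ × ℝ) : ℝ × ℝ × ℝ :=
  (σ * f.1, σ * (η * f.1), σ ^ 2 * (2 * κ * q.1 * f.1))

/-- The integrand of the area swept out by a deformation after `n` Euler steps. -/
def sweptCurl (c : Coeffs ℝ) (h : ℝ) (n : ℕ) (y ξ ζ : ℝ × ℝ × ℝ) : ℝ :=
  curl c ((eulerStep c h)^[n] y) ((jetStep c h)^[n] (y, ξ)).2 ((jetStep c h)^[n] (y, ζ)).2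

theorem exists_work_function (c : Coeffs ℝ) (h : ℝ) (n : ℕ) (κ : ℝ) :
    ∃ W : ℝ × ℝ × ℝ → ℝ, Continuous W ∧
      ∀ (U : ℝ → ℝ × ℝ × ℝ) (t : ℝ), HasDerivAt U (vf c (U t)) t → ∀ K,
      (∀ σ ∈ Set.Icc (0 : ℝ) 1, |sweptCurl c h n (ret1 c.η κ σ (U t)) (ret1S c.η κ (U t))
        (ret1D c.η κ σ (U t) (vf c (U t)))| ≤ K) →
      (∀ σ ∈ Set.Icc (0 : ℝ) 1, |sweptCurl c h n (ret2 c.η κ σ (U t)) (ret2S c.η κ σ (U t))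
        (ret2D c.η κ σ (U t) (vf c (U t)))| ≤ K) →
      ∃ d, HasDerivAt (fun t => W (U t)) d t ∧
        |d - dot (vf c ((eulerStep c h)^[n] (U t))) ((jetStep c h)^[n] (U t, vf c (U t))).2|
          ≤ 2 * K := by
  let X : Fin 4 → HPoly := MvPolynomial.X
  let C : ℝ →+* HPoly := MvPolynomial.C
  obtain ⟨k1, hk1⟩ := exists_primitive c h n (X 1, C c.η * X 1 + X 0 * (X 2 - C c.η * X 1),
    C κ * X 1 ^ 2 + X 0 * (X 3 - C κ * X 1 ^ 2))
  obtain ⟨k2, hk2⟩ := exists_primitive c h n (X 0 * X 1, X 0 * (C c.η * X 1),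
    X 0 ^ 2 * (C κ * X 1 ^ 2))
  have hcont : ∀ (k : HPoly) (σ : ℝ), Continuous fun q => eval (hpt σ q) k := fun k σ => by
    refine (MvPolynomial.continuous_eval k).comp (continuous_pi fun i => ?_)
    fin_cases i <;> simp only [hpt] <;> dsimp <;> fun_prop
  refine ⟨fun q => (eval (hpt 1 q) k1 - eval (hpt 0 q) k1) +
    (eval (hpt 1 q) k2 - eval (hpt 0 q) k2), ?_, fun U t hU K h1 h2 => ?_⟩
  · exact ((hcont _ _).sub (hcont _ _)).add ((hcont _ _).sub (hcont _ _))
  have hd := fun (k : HPoly) σ => hasDerivAt_eval_flowD c σ hU k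
  refine ⟨_, (((hd k1 1).sub (hd k1 0)).add ((hd k2 1).sub (hd k2 0))), ?_⟩
  set q := U t with hq
  have hs := map3_homD_phase
  have hf := map3_flowD_phase c
  simp only [map3, phase, Prod.ext_iff, Prod.fst_zero, Prod.snd_zero] at hs hf
  obtain ⟨hs1, hs2, hs3⟩ := hs
  obtain ⟨hf1, hf2, hf3⟩ := hf
  have hs0 := homD_X_zero
  have hf0 := flowD_X_zero c
  have hfe : ∀ σ, (eval (hpt σ q) (vf c.poly phase).1, eval (hpt σ q) (vf c.poly phase).2.1,
      eval (hpt σ q) (vf c.poly phase).2.2) = vf c q := fun σ => by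
    have := map3_vf (eval (hpt σ q)) c.poly phase
    rwa [c.map_eval_poly, map3_eval_phase] at this
  have hfe1 := fun σ => congrArg Prod.fst (hfe σ)
  have hfe2 := fun σ => congrArg (fun z => z.2.1) (hfe σ)
  have hfe3 := fun σ => congrArg (fun z => z.2.2) (hfe σ)
  have hDC : ∀ (E : Derivation ℝ HPoly HPoly) (x : ℝ), E (MvPolynomial.C x) = 0 :=
    fun E x => MvPolynomial.derivation_C E x
  simp only [phase] at hfe1 hfe2 hfe3
  have hx0 : ∀ σ, hpt σ q 0 = σ := fun _ => rfl
  have hx1 : ∀ σ, hpt σ q 1 = q.1 := fun _ => rfl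
  have hx2 : ∀ σ, hpt σ q 2 = q.2.1 := fun _ => rfl
  have hx3 : ∀ σ, hpt σ q 3 = q.2.2 := fun _ => rfl
  have b1 := hk1 q K
    (fun σ => (eulerStep c h)^[n] (ret1 c.η κ σ q))
    (fun σ => ((jetStep c h)^[n] (ret1 c.η κ σ q, ret1S c.η κ q)).2)
    (fun σ => ((jetStep c h)^[n] (ret1 c.η κ σ q, ret1D c.η κ σ q (vf c q))).2)
    (fun σ => by
      rw [← jetStep_iterate_fst c h (ret1 c.η κ σ q, ret1S c.η κ q), Prod.mk.eta]
      congr 2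
      · simp [map3, ret1, X, C, hx0, hx1, hx2, hx3]
      · simp [map3, ret1S, X, C, hx1, hx2, hx3, hs1, hs2, hs3, hs0, hDC])
    (fun σ => by
      rw [← jetStep_iterate_fst c h (ret1 c.η κ σ q, ret1D c.η κ σ q (vf c q)), Prod.mk.eta]
      congr 2
      · simp [map3, ret1, X, C, hx0, hx1, hx2, hx3]
      · simp [map3, ret1D, X, C, hx0, hx1, hf1, hf2, hf3, hf0, hfe1, hfe2, hfe3, hDC]
        ring)
    h1
  have b2 := hk2 q K
    (fun σ => (eulerStep c h)^[n] (ret2 c.η κ σ q))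
    (fun σ => ((jetStep c h)^[n] (ret2 c.η κ σ q, ret2S c.η κ σ q)).2)
    (fun σ => ((jetStep c h)^[n] (ret2 c.η κ σ q, ret2D c.η κ σ q (vf c q))).2)
    (fun σ => by
      rw [← jetStep_iterate_fst c h (ret2 c.η κ σ q, ret2S c.η κ σ q), Prod.mk.eta]
      congr 2
      · simp [map3, ret2, X, C, hx0, hx1]
      · simp [map3, ret2S, X, C, hx0, hx1, hs1, hs0, hDC]
        ring)
    (fun σ => by
      rw [← jetStep_iterate_fst c h (ret2 c.η κ σ q, ret2D c.η κ σ q (vf c q)), Prod.mk.eta]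
      congr 2
      · simp [map3, ret2, X, C, hx0, hx1]
      · simp [map3, ret2D, X, C, hx0, hx1, hf1, hf0, hfe1, hDC]
        ring_nf
        simp)
    h2
  have e1 : ret1 c.η κ 1 q = q := by ext <;> simp [ret1]
  have e2 : ret1D c.η κ 1 q (vf c q) = vf c q := by ext <;> simp [ret1D]
  have e3 : ret2 c.η κ 1 q = ret1 c.η κ 0 q := by ext <;> simp [ret2, ret1]
  have e4 : ret2D c.η κ 1 q (vf c q) = ret1D c.η κ 0 q (vf c q) := by ext <;> simp [ret2D, ret1D]
  have e5 : ret2D c.η κ 0 q (vf c q) = 0 := by ext <;> simp [ret2D]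
  rw [e1, e2] at b1
  rw [e3, e4, e5, jetStep_iterate_zero] at b2
  have e6 : ∀ v : ℝ × ℝ × ℝ, dot v 0 = 0 := fun v => by simp [dot]
  rw [e6] at b2
  rw [abs_le] at b1 b2 ⊢
  constructor <;> linarith [b1.1, b1.2, b2.1, b2.2]

theorem IsCompact.exists_le_mul_of_homogeneous {X E : Type*} [TopologicalSpace X]
    [NormedAddCommGroup E] [NormedSpace ℝ E] [FiniteDimensional ℝ E] {K : Set X}
    (hK : IsCompact K) {f : X × E → ℝ} {Q : E → ℝ} {d : ℕ} (hf : Continuous f) (hQ : Continuous Q)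
    (hd : d ≠ 0)
    (hpos : ∀ n, n ≠ 0 → 0 < Q n) (hfd : ∀ x (r : ℝ) n, f (x, r • n) = r ^ d * f (x, n))
    (hQd : ∀ (r : ℝ) n, Q (r • n) = r ^ d * Q n) :
    ∃ M, 0 ≤ M ∧ ∀ x ∈ K, ∀ n, f (x, n) ≤ M * Q n := by
  have hs : IsCompact (K ×ˢ Metric.sphere (0 : E) 1) := hK.prod (isCompact_sphere _ _)
  have hne : ∀ z ∈ K ×ˢ Metric.sphere (0 : E) 1, Q z.2 ≠ 0 := fun z hz => by
    refine (hpos _ fun h0 => ?_).ne'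
    have := hz.2
    simp [h0] at this
  obtain ⟨M, hM⟩ := hs.exists_bound_of_continuousOn (f := fun z => f z / Q z.2)
    (hf.continuousOn.div (hQ.comp continuous_snd).continuousOn hne)
  refine ⟨max M 0, le_max_right _ _, fun x hx n => ?_⟩
  by_cases hn : n = 0
  · have h1 := hfd x 0 n
    have h2 := hQd 0 n
    simp only [zero_smul, zero_pow hd, zero_mul] at h1 h2
    rw [hn, h1, h2, mul_zero]
  have hnn : 0 < ‖n‖ := norm_pos_iff.2 hn
  set m := ‖n‖⁻¹ • n with hm
  have hmm : ‖n‖ • m = n := by rw [hm, smul_smul, mul_inv_cancel₀ hnn.ne', one_smul]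
  have hms : m ∈ Metric.sphere (0 : E) 1 := by
    simp [hm, norm_smul, hnn.ne']
  have h1 := hM (x, m) ⟨hx, hms⟩
  have hQm : 0 < Q m := hpos m fun h0 => by simp [h0] at hms
  have h2 : f (x, m) ≤ max M 0 * Q m := by
    rw [← div_le_iff₀ hQm]
    exact (le_abs_self _).trans (h1.trans (le_max_left _ _))
  rw [← hmm, hfd, hQd]
  nlinarith [pow_pos hnn d]

/-- `f` has the second order expansion `f + h f' + O(h ^ 2)` along Euler steps. -/
def EulerExp (c : Coeffs ℝ) (f f' : ℝ × ℝ × ℝ → ℝ) : Prop :=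
  Continuous f ∧ Continuous f' ∧ ∃ R : ℝ × ℝ × ℝ × ℝ → ℝ, Continuous R ∧
    ∀ h q, f (eulerStep c h q) = f q + h * f' q + h ^ 2 * R (h, q)

namespace EulerExp

variable {c : Coeffs ℝ} {f f' g g' : ℝ × ℝ × ℝ → ℝ}

theorem congr (hf : EulerExp c f f') (h : ∀ q, f' q = g' q) : EulerExp c f g' :=
  funext h ▸ hf

theorem const (a : ℝ) : EulerExp c (fun _ => a) (fun _ => 0) :=
  ⟨continuous_const, continuous_const, fun _ => 0, continuous_const, fun h q => by simp⟩

theorem add (hf : EulerExp c f f') (hg : EulerExp c g g') :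
    EulerExp c (fun q => f q + g q) (fun q => f' q + g' q) := by
  obtain ⟨f1, f2, R, hR, hfR⟩ := hf
  obtain ⟨g1, g2, S, hS, hgS⟩ := hg
  exact ⟨f1.add g1, f2.add g2, fun z => R z + S z, hR.add hS, fun h q => by
    dsimp only; rw [hfR, hgS]; ring⟩

theorem mul (hf : EulerExp c f f') (hg : EulerExp c g g') :
    EulerExp c (fun q => f q * g q) (fun q => f' q * g q + f q * g' q) := by
  obtain ⟨f1, f2, R, hR, hfR⟩ := hf
  obtain ⟨g1, g2, S, hS, hgS⟩ := hg
  exact ⟨f1.mul g1, (f2.mul g1).add (f1.mul g2), fun z => f z.2 * S z + f' z.2 * g' z.2 +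
    R z * g z.2 + z.1 * (f' z.2 * S z + R z * g' z.2) + z.1 ^ 2 * (R z * S z), by fun_prop,
    fun h q => by dsimp only; rw [hfR, hgS]; ring⟩

theorem const_mul (a : ℝ) (hf : EulerExp c f f') :
    EulerExp c (fun q => a * f q) (fun q => a * f' q) := by
  simpa using (const a).mul hf

theorem sq (hf : EulerExp c f f') : EulerExp c (fun q => f q ^ 2) (fun q => 2 * f q * f' q) := by
  have := hf.mul hf
  simp only [← _root_.sq] at this
  convert this using 2
  ring

theorem coord₁ : EulerExp c (fun q => q.1) (fun q => (vf c q).1) :=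
  ⟨by fun_prop, by unfold vf; fun_prop, fun _ => 0, continuous_const, fun h q => by
    simp [eulerStep]⟩

theorem coord₂ : EulerExp c (fun q => q.2.1) (fun q => (vf c q).2.1) :=
  ⟨by fun_prop, by unfold vf; fun_prop, fun _ => 0, continuous_const, fun h q => by
    simp [eulerStep]⟩

theorem coord₃ : EulerExp c (fun q => q.2.2) (fun q => (vf c q).2.2) :=
  ⟨by fun_prop, by unfold vf; fun_prop, fun _ => 0, continuous_const, fun h q => by
    simp [eulerStep]⟩

theorem exists_bound (hf : EulerExp c f f') {K : Set (ℝ × ℝ × ℝ)} (hK : IsCompact K) :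
    ∃ M, 0 ≤ M ∧ (∀ q ∈ K, |f q| ≤ M) ∧ ∀ q ∈ K, ∀ h ∈ Set.Icc (0 : ℝ) 1,
      |f (eulerStep c h q) - (f q + h * f' q)| ≤ h ^ 2 * M := by
  obtain ⟨f1, -, R, hR, hfR⟩ := hf
  obtain ⟨M, hM⟩ := hK.exists_bound_of_continuousOn f1.continuousOn
  obtain ⟨N, hN⟩ := (isCompact_Icc.prod hK).exists_bound_of_continuousOn
    (s := Set.Icc (0 : ℝ) 1 ×ˢ K) hR.continuousOn
  refine ⟨max 0 (max M N), le_max_left _ _, fun q hq => (hM q hq).trans (by simp), ?_⟩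
  intro q hq h hh
  have := (hN (h, q) ⟨hh, hq⟩).trans ((le_max_right M N).trans (le_max_right 0 _))
  rw [Real.norm_eq_abs] at this
  rw [hfR, add_sub_cancel_left, abs_mul, abs_of_nonneg (_root_.sq_nonneg h)]
  exact mul_le_mul_of_nonneg_left this (_root_.sq_nonneg h)

theorem exists_absorbing (hf : EulerExp c f f') (hcoe : ∀ A, ∃ K, IsCompact K ∧ {q | f q ≤ A} ⊆ K)
    {m C : ℝ} (hm : 0 < m) (hdec : ∀ q, f' q ≤ -m * f q + C) {B : Set (ℝ × ℝ × ℝ)}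
    (hB : IsCompact B) :
    ∃ K, IsCompact K ∧ ∃ h₀ > 0, ∀ h ∈ Set.Icc 0 h₀, ∀ q ∈ B, ∀ n, (eulerStep c h)^[n] q ∈ K := by
  obtain ⟨A₀, hA₀⟩ := hB.exists_bound_of_continuousOn hf.1.continuousOn
  set A := max A₀ ((C + 1) / m) with hA
  obtain ⟨K, hK, hAK⟩ := hcoe A
  obtain ⟨M, hM0, -, hM⟩ := hf.exists_bound hK
  refine ⟨K, hK, min 1 (min (1 / m) (1 / (M + 1))), by positivity, fun h hh q hq n => ?_⟩
  obtain ⟨h0, h1⟩ := hh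
  simp only [le_min_iff] at h1
  obtain ⟨h1, h2, h3⟩ := h1
  rw [le_div_iff₀ hm] at h2
  rw [le_div_iff₀ (by positivity)] at h3
  have hAm : C + 1 ≤ A * m := by
    rw [← div_le_iff₀ hm]; exact le_max_right _ _
  have key : ∀ n, f ((eulerStep c h)^[n] q) ≤ A := by
    intro n
    induction n with
    | zero => exact (le_abs_self _).trans ((hA₀ q hq).trans (le_max_left _ _))
    | succ n ih =>
      rw [Function.iterate_succ_apply']
      set y := (eulerStep c h)^[n] q
      have e1 := (abs_le.1 (hM y (hAK ih) h ⟨h0, h1⟩)).2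
      have e2 := mul_le_mul_of_nonneg_left (hdec y) h0
      have e3 := mul_le_mul_of_nonneg_right ih (sub_nonneg.2 h2)
      nlinarith [mul_nonneg h0 (sub_nonneg.2 h3), mul_nonneg h0 (sub_nonneg.2 hAm)]
  exact hAK (key n)

end EulerExp

noncomputable def adaptedCoeffs (s τ r η a : ℝ) : Coeffs ℝ :=
  ⟨s, r, η, a, 1/2 - a, τ - 1/2 + a - 2*a*η⟩

theorem exists_eulerExp_potential (s τ r η a v1 v2 v3 v4 v5 : ℝ) :
    ∃ V, EulerExp (adaptedCoeffs s τ r η a) V fun q =>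
      potRate s r (τ - 1/2) v1 v2 v3 v4 v5 q.1 (q.2.1 - η * q.1) (q.2.2 - a * q.1 ^ 2) := by
  set c := adaptedCoeffs s τ r η a
  have hx := EulerExp.coord₁ (c := c)
  have hp := (EulerExp.coord₂ (c := c)).add (hx.const_mul (-η))
  have hX := hx.sq
  have hω := (EulerExp.coord₃ (c := c)).add (hX.const_mul (-a))
  refine ⟨_, (((((hω.const_mul v1).add ((hx.mul hp).const_mul v2)).add (hω.sq.const_mul v3)).add
      ((((hp.sq.add (hX.sq.const_mul (1/4))).add (hX.mul hω)).add
        (hX.const_mul (-r))).const_mul v4)).add (hX.const_mul v5)).congr fun q => ?_⟩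
  simp only [potRate, vf, c, adaptedCoeffs]
  ring

theorem exists_absorbing_adapted {s τ r η a : ℝ} (hτ : 0 < τ) (hs : τ < s)
    {B : Set (ℝ × ℝ × ℝ)} (hB : IsCompact B) :
    ∃ K, IsCompact K ∧ ∃ h₀ > 0, ∀ h ∈ Set.Icc 0 h₀, ∀ q ∈ B, ∀ n,
      (eulerStep (adaptedCoeffs s τ r η a) h)^[n] q ∈ K := by
  set c := adaptedCoeffs s τ r η a
  set k := s + r / τ with hk
  have hx := EulerExp.coord₁ (c := c)
  have hp := (EulerExp.coord₂ (c := c)).add (hx.const_mul (-η))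
  have hX := hx.sq
  have hω := (EulerExp.coord₃ (c := c)).add (hX.const_mul (-a))
  have hy := hx.add (hp.const_mul τ⁻¹)
  have hz := (hω.add (hX.const_mul (1/2))).const_mul τ⁻¹
  have hL := (hX.add hy.sq).add (hz.add (EulerExp.const (-k))).sq
  set m := min (2 * τ) (min (2 * (s - τ)) 1) with hm
  have m1 : m ≤ 2 * τ := min_le_left _ _
  have m2 : m ≤ 2 * (s - τ) := (min_le_right _ _).trans (min_le_left _ _)
  have m3 : m ≤ 1 := (min_le_right _ _).trans (min_le_right _ _)
  have m0 : 0 < m := lt_min (by linarith) (lt_min (by linarith) one_pos)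
  refine hL.exists_absorbing ?_ m0 (C := (k * (1 - m)) ^ 2 + m * k ^ 2) ?_ hB
  · intro A
    refine ⟨(fun v : ℝ × ℝ × ℝ => (v.1, τ * (v.2.1 - v.1) + η * v.1,
      τ * (v.2.2 + k) - 1/2 * v.1 ^ 2 + a * v.1 ^ 2)) '' Metric.closedBall 0 (1 + |A|),
      (isCompact_closedBall _ _).image (by fun_prop), fun q hq => ?_⟩
    simp only [Set.mem_ofPred_eq] at hq
    have hA := le_abs_self A
    have hb : ∀ x : ℝ, x ^ 2 ≤ A → ‖x‖ ≤ 1 + |A| := fun x hx => by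
      rw [Real.norm_eq_abs]
      refine abs_le_of_sq_le_sq (by nlinarith [abs_nonneg A]) (by positivity)
    refine ⟨(q.1, q.1 + τ⁻¹ * (q.2.1 + -η * q.1),
      τ⁻¹ * (q.2.2 + -a * q.1 ^ 2 + 1/2 * q.1 ^ 2) + -k), ?_, ?_⟩
    · rw [mem_closedBall_zero_iff, Prod.norm_mk, Prod.norm_mk]
      refine max_le (hb _ ?_) (max_le (hb _ ?_) (hb _ ?_)) <;>
      nlinarith [sq_nonneg q.1, sq_nonneg (q.1 + τ⁻¹ * (q.2.1 + -η * q.1)),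
        sq_nonneg (τ⁻¹ * (q.2.2 + -a * q.1 ^ 2 + 1/2 * q.1 ^ 2) + -k)]
    · ext
      · rfl
      · dsimp only; field_simp; ring
      · dsimp only; field_simp; ring
  · rintro ⟨x, P, χ⟩
    obtain ⟨y, rfl⟩ : ∃ y, P = τ * (y - x) + η * x := ⟨x + τ⁻¹ * (P - η * x), by field_simp; ring⟩
    obtain ⟨z, rfl⟩ : ∃ z, χ = τ * z - 1/2 * x ^ 2 + a * x ^ 2 :=
      ⟨τ⁻¹ * (χ - a * x ^ 2 + 1/2 * x ^ 2), by field_simp; ring⟩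
    have e1 : x + τ⁻¹ * (τ * (y - x) + η * x + -η * x) = y := by field_simp; ring
    have e2 : τ⁻¹ * (τ * z - 1/2 * x ^ 2 + a * x ^ 2 + -a * x ^ 2 + 1/2 * x ^ 2) = z := by
      field_simp; ring
    simp only [vf, c, adaptedCoeffs, e1, e2]
    have hr : r = (k - s) * τ := by rw [hk]; field_simp; ring
    rw [hr]
    have e3 : ∀ D : ℝ, D = -2 * τ * x ^ 2 - 2 * (s - τ) * y ^ 2 - 2 * z ^ 2 + 2 * k * z →
        D ≤ -m * (x ^ 2 + y ^ 2 + (z + -k) ^ 2) + ((k * (1 - m)) ^ 2 + m * k ^ 2) := fun D hD => by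
      rw [hD]
      linarith [mul_nonneg (sub_nonneg.2 m1) (sq_nonneg x),
        mul_nonneg (sub_nonneg.2 m2) (sq_nonneg y),
        mul_nonneg (sub_nonneg.2 m3) (sq_nonneg z), sq_nonneg (z - k * (1 - m))]
    refine e3 _ ?_
    field_simp
    ring

/-- The coordinates of the two-vector `ξ ∧ ζ`. -/
def wedge (ξ ζ : ℝ × ℝ × ℝ) : ℝ × ℝ × ℝ :=
  (ξ.1 * ζ.2.1 - ξ.2.1 * ζ.1, ξ.1 * ζ.2.2 - ξ.2.2 * ζ.1, ξ.2.1 * ζ.2.2 - ξ.2.2 * ζ.2.1)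

/-- The second additive compound of `dvf c q`. -/
def addCompound (c : Coeffs ℝ) (q n : ℝ × ℝ × ℝ) : ℝ × ℝ × ℝ :=
  (-c.s * n.1 - q.1 * n.2.1,
    -(1 + c.η) * n.2.1 + 2 * c.a * q.1 * n.1 + n.2.2,
    -(1 + c.s - c.η) * n.2.2 +
      ((c.s - c.η) * c.η + c.r - 3 * c.b * q.1 ^ 2 - q.2.2) * n.2.1 -
      2 * (c.e * q.1 + c.a * q.2.1) * n.1)

/-- The second multiplicative compound of `dvf c q`. -/
def mulCompound (c : Coeffs ℝ) (q n : ℝ × ℝ × ℝ) : ℝ × ℝ × ℝ :=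
  let A := (c.s - c.η) * c.η + c.r - 3 * c.b * q.1 ^ 2 - q.2.2
  let B := 2 * (c.e * q.1 + c.a * q.2.1)
  ((c.η * (c.s - c.η) - A) * n.1 + c.η * q.1 * n.2.1 - q.1 * n.2.2,
    (-c.η * (2 * c.a * q.1) - B) * n.1 + c.η * n.2.1 - n.2.2,
    (A * (2 * c.a * q.1) - (c.η - c.s) * B) * n.1 + (-A + q.1 * B) * n.2.1 +
      (c.s - c.η + q.1 * (2 * c.a * q.1)) * n.2.2)

theorem wedge_add_smul_dvf (c : Coeffs ℝ) (h : ℝ) (q ξ ζ : ℝ × ℝ × ℝ) :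
    wedge (ξ + h • dvf c q ξ) (ζ + h • dvf c q ζ) =
      wedge ξ ζ + h • addCompound c q (wedge ξ ζ) + h ^ 2 • mulCompound c q (wedge ξ ζ) := by
  ext <;> simp [wedge, addCompound, mulCompound, dvf] <;> ring

theorem addCompound_smul (c : Coeffs ℝ) (k : ℝ) (q n : ℝ × ℝ × ℝ) :
    addCompound c q (k • n) = k • addCompound c q n := by
  ext <;> simp [addCompound] <;> ring

theorem mulCompound_smul (c : Coeffs ℝ) (k : ℝ) (q n : ℝ × ℝ × ℝ) :
    mulCompound c q (k • n) = k • mulCompound c q n := by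
  ext <;> simp [mulCompound] <;> ring

def curlForm (c : Coeffs ℝ) (q n : ℝ × ℝ × ℝ) : ℝ :=
  (1 - ((c.s - c.η) * c.η + c.r - 3 * c.b * q.1 ^ 2 - q.2.2)) * n.1 -
    2 * (c.e * q.1 + c.a * q.2.1) * n.2.1 - (1 + 2 * c.a) * q.1 * n.2.2

theorem curl_eq_curlForm (c : Coeffs ℝ) (q ξ ζ : ℝ × ℝ × ℝ) :
    curl c q ξ ζ = curlForm c q (wedge ξ ζ) := by
  simp [curl, curlForm, wedge, dot, dvf]
  ring

def areaForm (w a : ℝ) (m n : ℝ × ℝ × ℝ) : ℝ :=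
  2 * a * w * (m.1 * n.1) + w * (m.2.1 * n.2.1) + m.2.2 * n.2.2

theorem areaForm_pos {w a : ℝ} (hw : 0 < w) (ha : 0 < a) {n : ℝ × ℝ × ℝ} (hn : n ≠ 0) :
    0 < areaForm w a n n := by
  obtain ⟨e, b, c⟩ := n
  simp only [areaForm]
  have : e ≠ 0 ∨ b ≠ 0 ∨ c ≠ 0 := by
    by_contra! h
    exact hn (by simp [h])
  rcases this with h | h | h
  · have := mul_self_pos.2 h
    nlinarith [mul_pos (mul_pos hw ha) this, mul_nonneg hw.le (mul_self_nonneg b),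
      mul_self_nonneg c]
  · have := mul_self_pos.2 h
    nlinarith [mul_nonneg (mul_pos hw ha).le (mul_self_nonneg e), mul_pos hw this,
      mul_self_nonneg c]
  · have := mul_self_pos.2 h
    nlinarith [mul_nonneg (mul_pos hw ha).le (mul_self_nonneg e),
      mul_nonneg hw.le (mul_self_nonneg b)]

theorem exists_areaForm_step_le {s τ r η a w δ : ℝ} {V' : ℝ × ℝ × ℝ → ℝ} (hw : 0 < w) (ha : 0 < a)
    {K : Set (ℝ × ℝ × ℝ)} (hK : IsCompact K)
    (hdec : ∀ q n, areaForm w a n (addCompound (adaptedCoeffs s τ r η a) q n) ≤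
      -(V' q + δ) * areaForm w a n n) :
    ∃ M, 0 ≤ M ∧ ∀ h ∈ Set.Icc (0 : ℝ) 1, ∀ q ∈ K, ∀ ξ ζ,
      areaForm w a
        (wedge (ξ + h • dvf (adaptedCoeffs s τ r η a) q ξ)
          (ζ + h • dvf (adaptedCoeffs s τ r η a) q ζ))
        (wedge (ξ + h • dvf (adaptedCoeffs s τ r η a) q ξ)
          (ζ + h • dvf (adaptedCoeffs s τ r η a) q ζ)) ≤
      (1 - 2 * h * (V' q + δ) + M * h ^ 2) * areaForm w a (wedge ξ ζ) (wedge ξ ζ) := by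
  set c := adaptedCoeffs s τ r η a
  obtain ⟨M, hM0, hM⟩ := (isCompact_Icc.prod hK).exists_le_mul_of_homogeneous
    (K := Set.Icc (0 : ℝ) 1 ×ˢ K) (d := 2) (Q := fun n => areaForm w a n n)
    (f := fun z => areaForm w a (addCompound c z.1.2 z.2) (addCompound c z.1.2 z.2) +
      2 * areaForm w a z.2 (mulCompound c z.1.2 z.2) +
      2 * z.1.1 * areaForm w a (addCompound c z.1.2 z.2) (mulCompound c z.1.2 z.2) +
      z.1.1 ^ 2 * areaForm w a (mulCompound c z.1.2 z.2) (mulCompound c z.1.2 z.2))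
    (by simp only [areaForm, addCompound, mulCompound]; fun_prop)
    (by simp only [areaForm]; fun_prop) two_ne_zero
    (fun n hn => areaForm_pos hw ha hn)
    (fun z k n => by
      simp only [addCompound_smul, mulCompound_smul, areaForm, Prod.smul_fst, Prod.smul_snd,
        smul_eq_mul]
      ring)
    (fun k n => by
      simp only [areaForm, Prod.smul_fst, Prod.smul_snd, smul_eq_mul]
      ring)
  refine ⟨M, hM0, fun h hh q hq ξ ζ => ?_⟩
  rw [wedge_add_smul_dvf]
  set n := wedge ξ ζ
  have h1 := hM (h, q) ⟨hh, hq⟩ n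
  have h2 := hdec q n
  dsimp only at h1
  have e : areaForm w a (n + h • addCompound c q n + h ^ 2 • mulCompound c q n)
      (n + h • addCompound c q n + h ^ 2 • mulCompound c q n) = areaForm w a n n +
      2 * h * areaForm w a n (addCompound c q n) + h ^ 2 *
      (areaForm w a (addCompound c q n) (addCompound c q n) +
      2 * areaForm w a n (mulCompound c q n) +
      2 * h * areaForm w a (addCompound c q n) (mulCompound c q n) +
      h ^ 2 * areaForm w a (mulCompound c q n) (mulCompound c q n)) := by
    simp only [areaForm, Prod.smul_fst, Prod.smul_snd, smul_eq_mul, Prod.fst_add, Prod.snd_add]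
    ring
  rw [e]
  nlinarith [mul_le_mul_of_nonneg_left h1 (sq_nonneg h), mul_le_mul_of_nonneg_left h2 hh.1]

theorem exists_sweptCurl_decay {s τ r η a θ : ℝ} (hτ : 1/2 < τ) (hs : τ < s) (hr : r < 1 + s)
    (H : IsAdmissible s τ η a θ) {K : Set (ℝ × ℝ × ℝ)} (hK : IsCompact K) :
    ∃ C ≥ 0, ∃ δ > 0, ∃ h₁ > 0, ∀ h ∈ Set.Icc 0 h₁, ∀ N y ξ ζ,
      (∀ n, (eulerStep (adaptedCoeffs s τ r η a) h)^[n] y ∈ K) →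
      sweptCurl (adaptedCoeffs s τ r η a) h N y ξ ζ ^ 2 ≤
        C * Real.exp (-(δ * (h * N))) * ‖wedge ξ ζ‖ ^ 2 := by
  obtain ⟨w, v1, v2, v3, v4, v5, δ, hw, hδ, hdec⟩ := exists_compound_decay hτ hs hr H
  obtain ⟨V, hV⟩ := exists_eulerExp_potential s τ r η a v1 v2 v3 v4 v5
  have ha := H.a_pos
  set c := adaptedCoeffs s τ r η a with hc
  set V' : ℝ × ℝ × ℝ → ℝ := fun q =>
      potRate s r (τ - 1/2) v1 v2 v3 v4 v5 q.1 (q.2.1 - η * q.1) (q.2.2 - a * q.1 ^ 2) with hV'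
  obtain ⟨M, hM0, hM⟩ := exists_areaForm_step_le (s := s) (τ := τ) (r := r) (η := η) (δ := δ)
    (V' := V') hw ha hK (fun q n => by
      have := hdec q.1 (q.2.1 - η * q.1) (q.2.2 - a * q.1 ^ 2) n.1 n.2.1 n.2.2
      simp only [areaForm, addCompound, adaptedCoeffs, hV']
      linarith)
  rw [← hc] at hM
  obtain ⟨P, hP0, hPV, hP⟩ := hV.exists_bound hK
  obtain ⟨C₁, hC₁0, hC₁⟩ := hK.exists_le_mul_of_homogeneous (d := 2)
    (Q := fun n => areaForm w a n n) (f := fun z => curlForm c z.1 z.2 ^ 2)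
    (by simp only [curlForm]; fun_prop)
    (by simp only [areaForm]; fun_prop) two_ne_zero
    (fun n hn => areaForm_pos hw ha hn)
    (fun z k n => by
      simp only [curlForm, Prod.smul_fst, Prod.smul_snd, smul_eq_mul]
      ring)
    (fun k n => by
      simp only [areaForm, Prod.smul_fst, Prod.smul_snd, smul_eq_mul]
      ring)
  obtain ⟨C₂, hC₂0, hC₂⟩ := (isCompact_singleton (x := (0 : ℝ))).exists_le_mul_of_homogeneous
    (d := 2) (Q := fun n : ℝ × ℝ × ℝ => ‖n‖ ^ 2) (f := fun z => areaForm w a z.2 z.2)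
    (by simp only [areaForm]; fun_prop) (by fun_prop) two_ne_zero
    (fun n hn => by positivity)
    (fun z k n => by
      simp only [areaForm, Prod.smul_fst, Prod.smul_snd, smul_eq_mul]
      ring)
    (fun k n => by rw [norm_smul, mul_pow, Real.norm_eq_abs, sq_abs])
  refine ⟨C₁ * Real.exp (4 * P) * C₂, by positivity, δ, hδ, min 1 (δ / (M + 2 * P + 1)),
    by positivity, fun h hh N y ξ ζ hy => ?_⟩
  obtain ⟨h0, h1⟩ := hh
  obtain ⟨h1, h2⟩ := le_min_iff.1 h1
  rw [le_div_iff₀ (by positivity)] at h2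
  set n : ℕ → ℝ × ℝ × ℝ := fun k =>
    wedge ((jetStep c h)^[k] (y, ξ)).2 ((jetStep c h)^[k] (y, ζ)).2 with hn
  have key : ∀ k : ℕ, areaForm w a (n k) (n k) * Real.exp (2 * V ((eulerStep c h)^[k] y)) ≤
      Real.exp (-(δ * (h * k))) * (areaForm w a (n 0) (n 0) * Real.exp (2 * V y)) := by
    intro k
    induction k with
    | zero => simp
    | succ k ih =>
      set q := (eulerStep c h)^[k] y with hq
      have hqK : q ∈ K := hy k
      have e1 : ∀ ξ, ((jetStep c h)^[k + 1] (y, ξ)).2 =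
          ((jetStep c h)^[k] (y, ξ)).2 + h • dvf c q ((jetStep c h)^[k] (y, ξ)).2 := fun ξ => by
        rw [Function.iterate_succ_apply', hq, ← jetStep_iterate_fst c h (y, ξ)]
        rfl
      have hstep := hM h ⟨h0, h1⟩ q hqK ((jetStep c h)^[k] (y, ξ)).2 ((jetStep c h)^[k] (y, ζ)).2
      rw [← e1, ← e1] at hstep
      change areaForm w a (n (k + 1)) (n (k + 1)) ≤ _ * areaForm w a (n k) (n k) at hstep
      have hnn : 0 ≤ areaForm w a (n k) (n k) := by
        by_cases h0 : n k = 0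
        · rw [h0]; simp [areaForm]
        · exact (areaForm_pos hw ha h0).le
      have hPq := (abs_le.1 (hP q hqK h ⟨h0, h1⟩)).2
      rw [Function.iterate_succ_apply', ← hq]
      have e2 : 1 - 2 * h * (V' q + δ) + M * h ^ 2 ≤
          Real.exp (-2 * h * (V' q + δ) + M * h ^ 2) := by
        linarith [Real.add_one_le_exp (-2 * h * (V' q + δ) + M * h ^ 2)]
      calc areaForm w a (n (k + 1)) (n (k + 1)) * Real.exp (2 * V (eulerStep c h q))
          ≤ (Real.exp (-2 * h * (V' q + δ) + M * h ^ 2) * areaForm w a (n k) (n k)) *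
            Real.exp (2 * V (eulerStep c h q)) := by
            gcongr
            exact hstep.trans (mul_le_mul_of_nonneg_right e2 hnn)
        _ = areaForm w a (n k) (n k) *
            Real.exp (-2 * h * (V' q + δ) + M * h ^ 2 + 2 * V (eulerStep c h q)) := by
            rw [Real.exp_add _ (2 * V _)]; ring
        _ ≤ areaForm w a (n k) (n k) * Real.exp (-(δ * h) + 2 * V q) := by
            refine mul_le_mul_of_nonneg_left (Real.exp_le_exp.2 ?_) hnn
            nlinarith [mul_le_mul_of_nonneg_left h2 h0, sq_nonneg h]
        _ = Real.exp (-(δ * h)) * (areaForm w a (n k) (n k) * Real.exp (2 * V q)) := by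
            rw [Real.exp_add]; ring
        _ ≤ Real.exp (-(δ * h)) * (Real.exp (-(δ * (h * k))) *
            (areaForm w a (n 0) (n 0) * Real.exp (2 * V y))) := by gcongr
        _ = _ := by
            rw [← mul_assoc, ← Real.exp_add]
            push_cast
            ring_nf
  have h3 := key N
  have h4 := hC₁ _ (hy N) (n N)
  have h5 := hC₂ 0 rfl (n 0)
  have hV0 := (abs_le.1 (hPV y (hy 0))).2
  have hVN := (abs_le.1 (hPV _ (hy N))).1
  dsimp only at h4 h5
  rw [sweptCurl, curl_eq_curlForm]
  refine h4.trans ?_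
  have h6 : areaForm w a (n N) (n N) ≤
      Real.exp (-(δ * (h * N))) * (C₂ * ‖n 0‖ ^ 2) * Real.exp (4 * P) := by
    have h7 : areaForm w a (n N) (n N) = areaForm w a (n N) (n N) *
        Real.exp (2 * V ((eulerStep c h)^[N] y)) *
        Real.exp (-(2 * V ((eulerStep c h)^[N] y))) := by
      rw [mul_assoc, ← Real.exp_add]; simp
    rw [h7]
    calc _ ≤ Real.exp (-(δ * (h * N))) * ((C₂ * ‖n 0‖ ^ 2) * Real.exp (2 * P)) *
          Real.exp (2 * P) := by
          refine mul_le_mul (h3.trans ?_) (Real.exp_le_exp.2 (by linarith)) (by positivity)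
            (by positivity)
          refine mul_le_mul_of_nonneg_left ?_ (by positivity)
          exact mul_le_mul h5 (Real.exp_le_exp.2 (by linarith)) (by positivity) (by positivity)
      _ = _ := by
        rw [show (4 : ℝ) * P = 2 * P + 2 * P by ring, Real.exp_add]; ring
  calc _ ≤ C₁ * (Real.exp (-(δ * (h * N))) * (C₂ * ‖n 0‖ ^ 2) * Real.exp (4 * P)) := by gcongr
    _ = _ := by simp only [hn, Function.iterate_zero, id]; ring

theorem hasDerivAt_vf (c : Coeffs ℝ) {U : ℝ → ℝ × ℝ × ℝ} {U' : ℝ × ℝ × ℝ} {t : ℝ}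
    (h : HasDerivAt U U' t) : HasDerivAt (fun t => vf c (U t)) (dvf c (U t) U') t := by
  have h1 := h.prod_fst
  have h2 := h.prod_snd.prod_fst
  have h3 := h.prod_snd.prod_snd
  have g1 := h2.sub (h1.const_mul c.η)
  have g2 := (g1.const_mul (c.η - c.s)).add
    (h1.mul ((((h1.pow 2).const_mul c.b).const_sub c.r).sub h3))
  have g3 := (((h1.pow 2).const_mul c.e).sub h3).add ((h1.const_mul (2 * c.a)).mul h2)
  refine ((g1.prodMk (g2.prodMk g3)).congr_deriv ?_)
  ext
  · simp [dvf]
  · simp [dvf]; ring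
  · simp [dvf]; ring

/-- Local estimates for `vf c` on a set, with a single constant `L`. -/
structure VfBounds (c : Coeffs ℝ) (K : Set (ℝ × ℝ × ℝ)) (L : ℝ) : Prop where
  one_le : 1 ≤ L
  lipschitz : ∀ q ∈ K, ∀ q' ∈ K, ‖vf c q - vf c q'‖ ≤ L * ‖q - q'‖
  dvf_le : ∀ q ∈ K, ∀ ξ, ‖dvf c q ξ‖ ≤ L * ‖ξ‖
  step : ∀ q ∈ K, ∀ h ∈ Set.Icc (0 : ℝ) 1,
    ‖vf c (eulerStep c h q) - vf c q - h • dvf c q (vf c q)‖ ≤ h ^ 2 * (L * ‖vf c q‖)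

theorem exists_vfBounds (c : Coeffs ℝ) {K : Set (ℝ × ℝ × ℝ)} (hK : IsCompact K) :
    ∃ L, VfBounds c K L := by
  have hlin : ∀ (g : ((ℝ × ℝ × ℝ) × ℝ × (ℝ × ℝ × ℝ)) → (ℝ × ℝ × ℝ) → ℝ × ℝ × ℝ),
      Continuous (fun z : _ × _ => g z.1 z.2) → (∀ z (k : ℝ) n, g z (k • n) = k • g z n) →
      ∃ M, 0 ≤ M ∧ ∀ q ∈ K, ∀ h ∈ Set.Icc (0 : ℝ) 1, ∀ q' ∈ K, ∀ n,
        ‖g (q, h, q') n‖ ≤ M * ‖n‖ := by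
    intro g hg hgk
    obtain ⟨M, h0, hM⟩ := (hK.prod (isCompact_Icc.prod hK)).exists_le_mul_of_homogeneous
      (K := K ×ˢ (Set.Icc (0 : ℝ) 1 ×ˢ K)) (d := 2) (f := fun z => ‖g z.1 z.2‖ ^ 2)
      (Q := fun n => ‖n‖ ^ 2) (hg.norm.pow 2) (by fun_prop) two_ne_zero
      (fun n hn => by positivity)
      (fun z k n => by
        dsimp only
        rw [hgk, norm_smul, mul_pow, Real.norm_eq_abs, sq_abs])
      (fun k n => by rw [norm_smul, mul_pow, Real.norm_eq_abs, sq_abs])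
    refine ⟨M + 1, by positivity, fun q hq h hh q' hq' n => ?_⟩
    have h1 := hM (q, h, q') ⟨hq, hh, hq'⟩ n
    dsimp only at h1
    refine le_of_sq_le_sq ?_ (by positivity)
    nlinarith [sq_nonneg ‖n‖, mul_nonneg h0 (sq_nonneg ‖n‖),
      mul_nonneg (sq_nonneg M) (sq_nonneg ‖n‖)]
  obtain ⟨A, hA0, hA⟩ := hlin (fun z n => (n.2.1 - c.η * n.1,
      (c.η - c.s) * (n.2.1 - c.η * n.1) + c.r * n.1 -
        c.b * (z.1.1 ^ 2 + z.1.1 * z.2.2.1 + z.2.2.1 ^ 2) * n.1 -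
        (n.1 * z.1.2.2 + z.2.2.1 * n.2.2),
      c.e * (z.1.1 + z.2.2.1) * n.1 - n.2.2 +
        2 * c.a * (n.1 * z.1.2.1 + z.2.2.1 * n.2.1))) (by fun_prop) (fun z k n => by
      ext <;> simp <;> ring)
  obtain ⟨B, hB0, hB⟩ := hlin (fun z n => dvf c z.1 n) (by unfold dvf; fun_prop) (fun z k n => by
      ext <;> simp [dvf] <;> ring)
  obtain ⟨D, hD0, hD⟩ := hlin (fun z n => (0,
      -(c.b * (3 * z.1.1 * (vf c z.1).1 + z.2.1 * (vf c z.1).1 ^ 2)) * n.1 - (vf c z.1).1 * n.2.2,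
      c.e * (vf c z.1).1 * n.1 + 2 * c.a * (vf c z.1).1 * n.2.1)) (by unfold vf; fun_prop)
    (fun z k n => by ext <;> simp <;> ring)
  have h0 : (0 : ℝ) ∈ Set.Icc (0 : ℝ) 1 := by simp
  refine ⟨1 + A + B + D, by linarith, fun q hq q' hq' => ?_, fun q hq ξ => ?_, fun q hq h hh => ?_⟩
  · refine le_trans (le_of_eq ?_) ((hA q hq 0 h0 q' hq' (q - q')).trans ?_)
    · congr 1
      ext <;> simp [vf] <;> ring
    · gcongr; linarith
  · exact (hB q hq 0 h0 q hq ξ).trans (by gcongr; linarith)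
  · have e : vf c (eulerStep c h q) - vf c q - h • dvf c q (vf c q) = h ^ 2 • ((0,
        -(c.b * (3 * q.1 * (vf c q).1 + h * (vf c q).1 ^ 2)) * (vf c q).1 -
          (vf c q).1 * (vf c q).2.2,
        c.e * (vf c q).1 * (vf c q).1 + 2 * c.a * (vf c q).1 * (vf c q).2.1) : ℝ × ℝ × ℝ) := by
      ext <;> simp [vf, dvf, eulerStep] <;> ring
    rw [e, norm_smul, Real.norm_of_nonneg (sq_nonneg h)]
    refine mul_le_mul_of_nonneg_left ((hD q hq h hh q hq (vf c q)).trans ?_) (sq_nonneg h)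
    gcongr; linarith

theorem euler_gronwall {L h A : ℝ} (hL : 0 ≤ L) (hh : 0 ≤ h) (hA : 0 ≤ A) {a : ℕ → ℝ}
    (ha : a 0 ≤ 0) {N : ℕ} (hstep : ∀ k < N, a (k + 1) ≤ (1 + h * L) * a k + h * A) :
    ∀ k ≤ N, a k ≤ k * h * A * (1 + h * L) ^ k := by
  intro k
  induction k with
  | zero => simpa using ha
  | succ k ih =>
    intro hk
    have h1 : 1 ≤ (1 + h * L) ^ (k + 1) := one_le_pow₀ (by nlinarith [mul_nonneg hh hL])
    calc a (k + 1) ≤ (1 + h * L) * (k * h * A * (1 + h * L) ^ k) + h * A * 1 := by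
          rw [mul_one]
          refine (hstep k hk).trans ?_
          gcongr
          exact ih (by lia)
      _ ≤ (1 + h * L) * (k * h * A * (1 + h * L) ^ k) + h * A * (1 + h * L) ^ (k + 1) := by
          gcongr
      _ = _ := by push_cast; ring

theorem norm_vf_flow_le {c : Coeffs ℝ} {K : Set (ℝ × ℝ × ℝ)} {L : ℝ} (hB : VfBounds c K L)
    {U : ℝ → ℝ × ℝ × ℝ} (hU : ∀ s, 0 ≤ s → HasDerivAt U (vf c (U s)) s)
    (hUK : ∀ s, 0 ≤ s → U s ∈ K) {τ s : ℝ} (hτ : 0 ≤ τ) (hs : τ ≤ s) :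
    ‖vf c (U s)‖ ≤ Real.exp (L * (s - τ)) * ‖vf c (U τ)‖ := by
  have hd : ∀ x, 0 ≤ x → HasDerivAt (fun s => vf c (U s)) (dvf c (U x) (vf c (U x))) x :=
    fun x hx => hasDerivAt_vf c (hU x hx)
  have := norm_le_gronwallBound_of_norm_deriv_right_le (f := fun s => vf c (U s)) (K := L) (ε := 0)
    (a := τ) (b := s) (f' := fun x => dvf c (U x) (vf c (U x)))
    (fun x hx => (hd x (hτ.trans hx.1)).continuousAt.continuousWithinAt)
    (fun x hx => (hd x (hτ.trans hx.1)).hasDerivWithinAt) le_rfl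
    (fun x hx => by simpa using hB.dvf_le _ (hUK x (hτ.trans hx.1)) _) s (Set.right_mem_Icc.2 hs)
  rw [gronwallBound_ε0] at this
  rw [mul_comm]
  exact this

theorem one_add_mul_pow_le {L h t : ℝ} (hL : 0 ≤ L) (hh : 0 ≤ h) {k : ℕ} (hk : k * h ≤ t) :
    (1 + h * L) ^ k ≤ Real.exp (L * t) := by
  calc (1 + h * L) ^ k ≤ Real.exp (h * L) ^ k := by
        refine pow_le_pow_left₀ (by positivity) ?_ k
        linarith [Real.add_one_le_exp (h * L)]
    _ = Real.exp (k * (h * L)) := by rw [← Real.exp_nat_mul]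
    _ ≤ _ := Real.exp_le_exp.2 (by nlinarith)

theorem norm_vf_euler_le {c : Coeffs ℝ} {K : Set (ℝ × ℝ × ℝ)} {L h t : ℝ} (hB : VfBounds c K L)
    (hh : h ∈ Set.Icc (0 : ℝ) 1) {N : ℕ} (hN : N * h ≤ t) {y : ℝ × ℝ × ℝ}
    (hy : ∀ n, (eulerStep c h)^[n] y ∈ K) {k : ℕ} (hk : k ≤ N) :
    ‖vf c ((eulerStep c h)^[k] y)‖ ≤ Real.exp (L * t) * ‖vf c y‖ := by
  have hL : 0 ≤ L := zero_le_one.trans hB.one_le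
  have key : ‖vf c ((eulerStep c h)^[k] y)‖ ≤ (1 + h * L) ^ k * ‖vf c y‖ := by
    clear hk
    induction k with
    | zero => simp
    | succ k ih =>
      have h1 := hB.lipschitz _ (hy (k + 1)) _ (hy k)
      rw [Function.iterate_succ_apply'] at h1 ⊢
      set q := (eulerStep c h)^[k] y
      have h2 : ‖eulerStep c h q - q‖ = h * ‖vf c q‖ := by
        rw [eulerStep, add_sub_cancel_left, norm_smul, Real.norm_of_nonneg hh.1]
      rw [h2] at h1
      have h3 := norm_le_norm_add_norm_sub' (vf c (eulerStep c h q)) (vf c q)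
      calc _ ≤ (1 + h * L) * ‖vf c q‖ := by linarith
        _ ≤ (1 + h * L) * ((1 + h * L) ^ k * ‖vf c y‖) :=
          mul_le_mul_of_nonneg_left ih (by nlinarith [mul_nonneg hh.1 hL])
        _ = _ := by ring
  refine key.trans (mul_le_mul_of_nonneg_right (one_add_mul_pow_le hL hh.1 ?_) (norm_nonneg _))
  have : (k : ℝ) ≤ N := by exact_mod_cast hk
  exact (mul_le_mul_of_nonneg_right this hh.1).trans hN

theorem norm_jet_sub_vf_le {c : Coeffs ℝ} {K : Set (ℝ × ℝ × ℝ)} {L h t : ℝ} (hB : VfBounds c K L)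
    (hh : h ∈ Set.Icc (0 : ℝ) 1) {N : ℕ} (hN : N * h ≤ t) {y : ℝ × ℝ × ℝ}
    (hy : ∀ n, (eulerStep c h)^[n] y ∈ K) :
    ‖((jetStep c h)^[N] (y, vf c y)).2 - vf c ((eulerStep c h)^[N] y)‖ ≤
      t * (h * (L * (Real.exp (L * t) * ‖vf c y‖))) * Real.exp (L * t) := by
  have hL : 0 ≤ L := zero_le_one.trans hB.one_le
  have := euler_gronwall (L := L) (h := h) (A := h * (L * (Real.exp (L * t) * ‖vf c y‖)))
    (N := N) (a := fun k => ‖((jetStep c h)^[k] (y, vf c y)).2 - vf c ((eulerStep c h)^[k] y)‖)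
    hL hh.1 (by have := hh.1; positivity) (by simp) (fun k hk => by
      have h1 := hB.step _ (hy k) h hh
      have h2 := norm_vf_euler_le hB hh hN hy hk.le
      have e1 : ((jetStep c h)^[k + 1] (y, vf c y)).2 = ((jetStep c h)^[k] (y, vf c y)).2 +
          h • dvf c ((eulerStep c h)^[k] y) ((jetStep c h)^[k] (y, vf c y)).2 := by
        rw [Function.iterate_succ_apply', ← jetStep_iterate_fst c h (y, vf c y)]
        rfl
      rw [e1, Function.iterate_succ_apply']
      set q := (eulerStep c h)^[k] y
      set ζ := ((jetStep c h)^[k] (y, vf c y)).2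
      have e2 : ζ + h • dvf c q ζ - vf c (eulerStep c h q) = (ζ - vf c q) +
          h • dvf c q (ζ - vf c q) -
          (vf c (eulerStep c h q) - vf c q - h • dvf c q (vf c q)) := by
        have : dvf c q (ζ - vf c q) = dvf c q ζ - dvf c q (vf c q) := by
          ext <;> simp [dvf] <;> ring
        rw [this, smul_sub]
        abel
      rw [e2]
      refine (norm_sub_le _ _).trans ?_
      have h3 := norm_add_le (ζ - vf c q) (h • dvf c q (ζ - vf c q))
      rw [norm_smul, Real.norm_of_nonneg hh.1] at h3
      have h4 := mul_le_mul_of_nonneg_left (hB.dvf_le q (hy k) (ζ - vf c q)) hh.1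
      have h5 := mul_le_mul_of_nonneg_left (mul_le_mul_of_nonneg_left h2 hL) (sq_nonneg h)
      linarith) N le_rfl
  refine this.trans ?_
  have h1 := one_add_mul_pow_le (k := N) hL hh.1 hN
  have := hh.1
  have ht : 0 ≤ t := (by positivity : (0 : ℝ) ≤ N * h).trans hN
  gcongr

theorem norm_euler_sub_flow_le {c : Coeffs ℝ} {K : Set (ℝ × ℝ × ℝ)} {L h t : ℝ} (hB : VfBounds c K L)
    (hh : h ∈ Set.Icc (0 : ℝ) 1) {N : ℕ} (hN : N * h ≤ t) {y : ℝ × ℝ × ℝ}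
    (hy : ∀ n, (eulerStep c h)^[n] y ∈ K)
    {U : ℝ → ℝ × ℝ × ℝ}
    (hU : ∀ s, 0 ≤ s → HasDerivAt U (vf c (U s)) s)
    (hUK : ∀ s, 0 ≤ s → U s ∈ K) {τ : ℝ} (hτ : 0 ≤ τ) (hyU : U τ = y) :
    ‖(eulerStep c h)^[N] y - U (τ + N * h)‖ ≤
      t * (h * (L * (Real.exp (L * t) * ‖vf c y‖))) * Real.exp (L * t) := by
  have hL : 0 ≤ L := zero_le_one.trans hB.one_le
  have := euler_gronwall (L := L) (h := h) (A := h * (L * (Real.exp (L * t) * ‖vf c y‖)))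
    (N := N) (a := fun k => ‖(eulerStep c h)^[k] y - U (τ + k * h)‖)
    hL hh.1 (by have := hh.1; positivity) (by simp [hyU]) (fun k hk => by
      have hkh : 0 ≤ k * h := mul_nonneg (Nat.cast_nonneg k) hh.1
      have hk1 : (k + 1) * h ≤ t := by
        have : (k : ℝ) + 1 ≤ N := by exact_mod_cast hk
        exact (mul_le_mul_of_nonneg_right this hh.1).trans hN
      set a := τ + k * h with ha
      have ha0 : 0 ≤ a := by positivity
      have hb : τ + ((k + 1 : ℕ) : ℝ) * h = a + h := by push_cast; ring
      rw [Function.iterate_succ_apply', hb]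
      set q := (eulerStep c h)^[k] y
      have hG : ∀ s ∈ Set.Icc a (a + h), ‖vf c (U s)‖ ≤ Real.exp (L * t) * ‖vf c y‖ := fun s hs => by
        have h1 := norm_vf_flow_le hB hU hUK hτ (s := s) (by linarith [hs.1])
        rw [hyU] at h1
        refine h1.trans (mul_le_mul_of_nonneg_right (Real.exp_le_exp.2
          (mul_le_mul_of_nonneg_left ?_ hL)) (norm_nonneg _))
        linarith [hs.2]
      have hmv : ∀ s ∈ Set.Icc a (a + h), ‖U s - U a‖ ≤ Real.exp (L * t) * ‖vf c y‖ * h := by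
        intro s hs
        have h1 := (convex_Icc a (a + h)).norm_image_sub_le_of_norm_hasDerivWithin_le
          (fun x hx => (hU x (ha0.trans hx.1)).hasDerivWithinAt) hG
          (Set.left_mem_Icc.2 (by linarith [hh.1])) hs
        refine h1.trans (mul_le_mul_of_nonneg_left ?_ (by positivity))
        rw [Real.norm_eq_abs, abs_le]
        constructor <;> linarith [hs.1, hs.2]
      have hdef : ‖(U (a + h) - (a + h) • vf c (U a)) - (U a - a • vf c (U a))‖ ≤
          L * (Real.exp (L * t) * ‖vf c y‖ * h) * ‖(a + h) - a‖ := by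
        refine (convex_Icc a (a + h)).norm_image_sub_le_of_norm_hasDerivWithin_le
          (f := fun s => U s - s • vf c (U a)) (f' := fun s => vf c (U s) - vf c (U a))
          (fun x hx => ?_) (fun x hx => ?_)
          (Set.left_mem_Icc.2 (by linarith [hh.1])) (Set.right_mem_Icc.2 (by linarith [hh.1]))
        · have h1 := (hU x (ha0.trans hx.1)).sub ((hasDerivAt_id x).smul_const (vf c (U a)))
          rw [one_smul] at h1
          exact h1.hasDerivWithinAt
        · exact (hB.lipschitz _ (hUK x (ha0.trans hx.1)) _ (hUK a ha0)).trans
            (mul_le_mul_of_nonneg_left (hmv x hx) hL)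
      rw [add_sub_cancel_left, Real.norm_of_nonneg hh.1] at hdef
      have e1 : eulerStep c h q - U (a + h) = (q - U a) + h • (vf c q - vf c (U a)) -
          ((U (a + h) - (a + h) • vf c (U a)) - (U a - a • vf c (U a))) := by
        rw [eulerStep, smul_sub, add_smul]
        abel
      rw [e1]
      refine (norm_sub_le _ _).trans ?_
      have h3 := norm_add_le (q - U a) (h • (vf c q - vf c (U a)))
      rw [norm_smul, Real.norm_of_nonneg hh.1] at h3
      have h4 := mul_le_mul_of_nonneg_left (hB.lipschitz q (hy k) _ (hUK a ha0)) hh.1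
      linarith) N le_rfl
  refine this.trans ?_
  have h1 := one_add_mul_pow_le (k := N) hL hh.1 hN
  have := hh.1
  have ht : 0 ≤ t := (by positivity : (0 : ℝ) ≤ N * h).trans hN
  gcongr

theorem abs_dot_le (u v : ℝ × ℝ × ℝ) : |dot u v| ≤ 3 * (‖u‖ * ‖v‖) := by
  obtain ⟨a, b, c⟩ := u
  obtain ⟨x, y, z⟩ := v
  have ha : |a| ≤ ‖(a, b, c)‖ := norm_fst_le (a, b, c)
  have hb : |b| ≤ ‖(a, b, c)‖ := (norm_fst_le (b, c)).trans (norm_snd_le (a, b, c))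
  have hc : |c| ≤ ‖(a, b, c)‖ := (norm_snd_le (b, c)).trans (norm_snd_le (a, b, c))
  have hx : |x| ≤ ‖(x, y, z)‖ := norm_fst_le (x, y, z)
  have hy : |y| ≤ ‖(x, y, z)‖ := (norm_fst_le (y, z)).trans (norm_snd_le (x, y, z))
  have hz : |z| ≤ ‖(x, y, z)‖ := (norm_snd_le (y, z)).trans (norm_snd_le (x, y, z))
  simp only [dot]
  calc |a * x + b * y + c * z| ≤ |a| * |x| + |b| * |y| + |c| * |z| := by
        rw [← abs_mul, ← abs_mul, ← abs_mul]; exact abs_add_three _ _ _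
    _ ≤ ‖(a, b, c)‖ * ‖(x, y, z)‖ + ‖(a, b, c)‖ * ‖(x, y, z)‖ + ‖(a, b, c)‖ * ‖(x, y, z)‖ := by
        gcongr
    _ = _ := by ring

theorem sq_norm_le_dot_self (u : ℝ × ℝ × ℝ) : ‖u‖ ^ 2 ≤ dot u u := by
  obtain ⟨a, b, c⟩ := u
  have h : 0 ≤ dot (a, b, c) (a, b, c) := by
    simp only [dot]; nlinarith [mul_self_nonneg a, mul_self_nonneg b, mul_self_nonneg c]
  have : ‖(a, b, c)‖ ≤ √(dot (a, b, c) (a, b, c)) := by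
    simp only [Prod.norm_mk, Real.norm_eq_abs, dot]
    refine max_le ?_ (max_le ?_ ?_) <;> refine Real.abs_le_sqrt ?_ <;>
    nlinarith [mul_self_nonneg a, mul_self_nonneg b, mul_self_nonneg c]
  calc _ ≤ √(dot (a, b, c) (a, b, c)) ^ 2 := by gcongr
    _ = _ := Real.sq_sqrt h

theorem exists_euler_pairing_ge {c : Coeffs ℝ} {K : Set (ℝ × ℝ × ℝ)} (hK : IsCompact K) {t ε : ℝ}
    (ht : 0 < t) (hε : 0 < ε) {U : ℝ → ℝ × ℝ × ℝ}
    (hU : ∀ s, 0 ≤ s → HasDerivAt U (vf c (U s)) s) :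
    ∃ h₂ > 0, ∀ N : ℕ, ∀ h, 0 < h → h ≤ h₂ → N * h = t →
      (∀ s, 0 ≤ s → ∀ n, (eulerStep c h)^[n] (U s) ∈ K) → ∀ s, 0 ≤ s →
      dot (vf c (U (s + t))) (vf c (U (s + t))) - ε * dot (vf c (U s)) (vf c (U s)) ≤
        dot (vf c ((eulerStep c h)^[N] (U s))) ((jetStep c h)^[N] (U s, vf c (U s))).2 := by
  obtain ⟨L, hB⟩ := exists_vfBounds c hK
  have hL : 0 ≤ L := zero_le_one.trans hB.one_le
  set G := Real.exp (L * t) with hG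
  have hG0 : 0 < G := Real.exp_pos _
  set D := t * (L * G) * G with hD
  have hD0 : 0 ≤ D := by positivity
  refine ⟨min 1 (ε / (3 * (L * D * (G + (D + L * D)) + G * (D + L * D)) + 1)), by positivity,
    fun N h h0 hh hN hUK s hs => ?_⟩
  obtain ⟨hh1, hh2⟩ := le_min_iff.1 hh
  rw [le_div_iff₀ (by positivity)] at hh2
  have hUK' : ∀ s, 0 ≤ s → U s ∈ K := fun s hs => hUK s hs 0
  have hI : h ∈ Set.Icc (0 : ℝ) 1 := ⟨h0.le, hh1⟩
  set f := ‖vf c (U s)‖ with hf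
  have h1 := norm_jet_sub_vf_le hB hI hN.le (hUK s hs)
  have h2 := norm_euler_sub_flow_le hB hI hN.le (hUK s hs) hU hUK' hs rfl
  have h3 := norm_vf_flow_le hB hU hUK' hs (s := s + t) (by linarith)
  rw [hN] at h2
  rw [add_sub_cancel_left] at h3
  have h4 := hB.lipschitz _ (hUK s hs N) _ (hUK' (s + t) (by linarith))
  set A := vf c (U (s + t))
  set B := vf c ((eulerStep c h)^[N] (U s))
  set Z := ((jetStep c h)^[N] (U s, vf c (U s))).2
  have e1 : t * (h * (L * (G * f))) * G = h * D * f := by rw [hD]; ring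
  rw [← hG, ← hf, e1] at h1 h2
  rw [← hG, ← hf] at h3
  have hf0 : 0 ≤ f := norm_nonneg _
  have h5 : ‖B - A‖ ≤ h * (L * D) * f := h4.trans (by nlinarith [mul_le_mul_of_nonneg_left h2 hL])
  have h6 : ‖Z - A‖ ≤ h * (D + L * D) * f := by
    have := norm_add_le (Z - B) (B - A)
    rw [sub_add_sub_cancel] at this
    linarith
  have h7 : ‖Z‖ ≤ (G + (D + L * D)) * f := by
    have h8 := norm_add_le (Z - A) A
    rw [sub_add_cancel] at h8
    have : h * (D + L * D) * f ≤ 1 * (D + L * D) * f := by gcongr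
    linarith
  have e2 : dot B Z = dot A A + (dot (B - A) Z + dot A (Z - A)) := by
    simp only [dot, Prod.fst_sub, Prod.snd_sub]; ring
  have h8 := (abs_le.1 (abs_dot_le (B - A) Z)).1
  have h9 := (abs_le.1 (abs_dot_le A (Z - A))).1
  have h10 : ‖B - A‖ * ‖Z‖ ≤ (h * (L * D) * f) * ((G + (D + L * D)) * f) := by gcongr
  have h11 : ‖A‖ * ‖Z - A‖ ≤ (G * f) * (h * (D + L * D) * f) := by gcongr
  have h12 := sq_norm_le_dot_self (vf c (U s))
  rw [← hf] at h12
  have h13 : h * (3 * (L * D * (G + (D + L * D)) + G * (D + L * D)) + 1) * f ^ 2 ≤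
      ε * dot (vf c (U s)) (vf c (U s)) := by gcongr
  have h14 : 0 ≤ h * f ^ 2 := by positivity
  rw [e2]
  linarith

theorem wedge_smul_smul (k : ℝ) (u v : ℝ × ℝ × ℝ) : wedge (k • u) (k • v) = k ^ 2 • wedge u v := by
  ext <;> simp [wedge] <;> ring

theorem exists_memory_lyapunov {s τ r : ℝ} (hτ : 1/2 < τ) (hs : τ < s) (hr : r < 1 + s) :
    ∃ η a, ∀ U : ℝ → ℝ × ℝ × ℝ,
      (∀ x, 0 ≤ x → HasDerivAt U (vf (adaptedCoeffs s τ r η a) (U x)) x) →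
      (∃ R, ∀ x, 0 ≤ x → ‖U x‖ ≤ R) →
      ∃ t ≥ 0, ∃ H H' : ℝ → ℝ, (∃ M, ∀ x, 0 ≤ x → |H x| ≤ M) ∧ ∀ x, 0 ≤ x →
        HasDerivAt H (H' x) x ∧
        dot (vf (adaptedCoeffs s τ r η a) (U (x + t))) (vf (adaptedCoeffs s τ r η a) (U (x + t))) -
          1/2 * dot (vf (adaptedCoeffs s τ r η a) (U x)) (vf (adaptedCoeffs s τ r η a) (U x)) ≤
          H' x := by
  obtain ⟨η, a, θ, hadm⟩ := exists_isAdmissible hτ hs.le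
  refine ⟨η, a, fun U hU hR => ?_⟩
  obtain ⟨R, hR⟩ := hR
  set c := adaptedCoeffs s τ r η a with hc
  set κ := τ - 1/2 + a with hκ
  have hI : IsCompact (Set.Icc (0 : ℝ) 1 ×ˢ Metric.closedBall (0 : ℝ × ℝ × ℝ) R) :=
    isCompact_Icc.prod (isCompact_closedBall _ _)
  have hUI : ∀ σ ∈ Set.Icc (0 : ℝ) 1, ∀ x, 0 ≤ x →
      (σ, U x) ∈ Set.Icc (0 : ℝ) 1 ×ˢ Metric.closedBall (0 : ℝ × ℝ × ℝ) R := fun σ hσ x hx =>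
    ⟨hσ, mem_closedBall_zero_iff.2 (hR x hx)⟩
  have hB := (hI.image (f := fun z => ret1 η κ z.1 z.2) (by unfold ret1; fun_prop)).union
    (hI.image (f := fun z => ret2 η κ z.1 z.2) (by unfold ret2; fun_prop))
  obtain ⟨K, hK, h₀, hh₀, habs⟩ := exists_absorbing_adapted (s := s) (τ := τ) (r := r) (η := η)
    (a := a) (by linarith) hs hB
  rw [← hc] at habs
  obtain ⟨C, hC0, δ, hδ, h₁, hh₁, hdecay⟩ := exists_sweptCurl_decay hτ hs hr hadm hK
  rw [← hc] at hdecay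
  obtain ⟨M, hM0, hM⟩ := hI.exists_le_mul_of_homogeneous (d := 4)
    (f := fun z => ‖wedge (0, z.2.1, 2 * a * z.1.2.1 * z.2.1 - z.2.2.2)
      (ret1D η κ z.1.1 z.1.2 z.2)‖ ^ 2)
    (Q := fun f => dot f f ^ 2) (by unfold wedge ret1D; fun_prop) (by unfold dot; fun_prop)
    four_ne_zero
    (fun n hn => pow_pos ((by positivity : 0 < ‖n‖ ^ 2).trans_le (sq_norm_le_dot_self n)) 2)
    (fun z k n => by
      have e1 : ((0, (k • n).1, 2 * a * z.2.1 * (k • n).1 - (k • n).2.2) : ℝ × ℝ × ℝ) =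
          k • (0, n.1, 2 * a * z.2.1 * n.1 - n.2.2) := by
        ext <;> simp; ring
      have e2 : ret1D η κ z.1 z.2 (k • n) = k • ret1D η κ z.1 z.2 n := by
        ext <;> simp [ret1D] <;> ring
      dsimp only
      rw [e1, e2, wedge_smul_smul, norm_smul, mul_pow, Real.norm_eq_abs, sq_abs]
      ring)
    (fun k n => by simp only [dot, Prod.smul_fst, Prod.smul_snd, smul_eq_mul]; ring)
  set X := 64 * (C * M) + 2 with hX
  have hX1 : 1 < X := by nlinarith [mul_nonneg hC0 hM0]
  set t := Real.log X / δ with ht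
  have ht0 : 0 < t := div_pos (Real.log_pos hX1) hδ
  have hexp : Real.exp (-(δ * t)) * X = 1 := by
    rw [ht, mul_div_cancel₀ _ hδ.ne', Real.exp_neg, Real.exp_log (by linarith),
      inv_mul_cancel₀ (by linarith)]
  obtain ⟨h₂, hh₂, hpair⟩ := exists_euler_pairing_ge (c := c) hK ht0 (ε := 1/4) (by norm_num) hU
  obtain ⟨N, hN⟩ := exists_nat_gt (t / min h₀ (min h₁ h₂))
  have hm : 0 < min h₀ (min h₁ h₂) := lt_min hh₀ (lt_min hh₁ hh₂)
  have hN0 : (0 : ℝ) < N := (div_pos ht0 hm).trans hN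
  set h := t / N with hh
  have hpos : 0 < h := div_pos ht0 hN0
  have hle : h ≤ min h₀ (min h₁ h₂) := by
    rw [hh, div_le_iff₀ hN0]
    rw [div_lt_iff₀ hm] at hN
    linarith
  simp only [le_min_iff] at hle
  have hNh : N * h = t := by rw [hh]; field_simp
  have hstay1 : ∀ x, 0 ≤ x → ∀ σ ∈ Set.Icc (0 : ℝ) 1, ∀ n,
      (eulerStep c h)^[n] (ret1 η κ σ (U x)) ∈ K := fun x hx σ hσ =>
    habs h ⟨hpos.le, hle.1⟩ _ (Or.inl ⟨(σ, U x), hUI σ hσ x hx, rfl⟩)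
  have hstay2 : ∀ x, 0 ≤ x → ∀ σ ∈ Set.Icc (0 : ℝ) 1, ∀ n,
      (eulerStep c h)^[n] (ret2 η κ σ (U x)) ∈ K := fun x hx σ hσ =>
    habs h ⟨hpos.le, hle.1⟩ _ (Or.inr ⟨(σ, U x), hUI σ hσ x hx, rfl⟩)
  have hstay : ∀ x, 0 ≤ x → ∀ n, (eulerStep c h)^[n] (U x) ∈ K := fun x hx n => by
    have e : ret1 η κ 1 (U x) = U x := by ext <;> simp [ret1]
    have := hstay1 x hx 1 (by simp) n
    rwa [e] at this
  obtain ⟨W, hW, hwork⟩ := exists_work_function c h N κ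
  have hcη : c.η = η := rfl
  rw [hcη] at hwork
  have hd : ∀ x, 0 ≤ x → ∃ d, HasDerivAt (fun x => W (U x)) d x ∧
      dot (vf c (U (x + t))) (vf c (U (x + t))) - 1/2 * dot (vf c (U x)) (vf c (U x)) ≤ d := by
    intro x hx
    set f := vf c (U x) with hf
    have hf0 : 0 ≤ dot f f := (sq_nonneg _).trans (sq_norm_le_dot_self f)
    obtain ⟨d, hd, hdle⟩ := hwork U x (hU x hx) (1/8 * dot f f)
      (fun σ hσ => by
        refine abs_le_of_sq_le_sq ?_ (by positivity)
        refine (hdecay h ⟨hpos.le, hle.2.1⟩ N _ _ _ (hstay1 x hx σ hσ)).trans ?_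
        rw [mul_comm h, hNh]
        have e : ret1S η κ (U x) = (0, f.1, 2 * a * (U x).1 * f.1 - f.2.2) := by
          ext <;> simp [ret1S, hf, vf, hc, adaptedCoeffs, hκ]; ring
        have h1 := hM (σ, U x) (hUI σ hσ x hx) f
        dsimp only at h1
        rw [← e] at h1
        calc _ ≤ C * Real.exp (-(δ * t)) * (M * dot f f ^ 2) := by gcongr
          _ = (C * M) * Real.exp (-(δ * t)) * dot f f ^ 2 := by ring
          _ ≤ 1/64 * dot f f ^ 2 := by
            gcongr
            rw [hX] at hexp
            nlinarith [Real.exp_pos (-(δ * t))]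
          _ = _ := by ring)
      (fun σ hσ => by
        refine abs_le_of_sq_le_sq ?_ (by positivity)
        refine (hdecay h ⟨hpos.le, hle.2.1⟩ N _ _ _ (hstay2 x hx σ hσ)).trans ?_
        have e : wedge (ret2S η κ σ (U x)) (ret2D η κ σ (U x) f) = 0 := by
          ext <;> simp [ret2S, ret2D, wedge] <;> ring
        rw [e]
        simp only [norm_zero]
        rw [zero_pow two_ne_zero, mul_zero]
        positivity)
    refine ⟨d, hd, ?_⟩
    have h1 := hpair N h hpos hle.2.2 hNh hstay x hx
    have h2 := (abs_le.1 hdle).1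
    linarith
  choose! d hd using hd
  obtain ⟨Mw, hMw⟩ := (isCompact_closedBall (0 : ℝ × ℝ × ℝ) R).exists_bound_of_continuousOn
    hW.continuousOn
  exact ⟨t, ht0.le, fun x => W (U x), d,
    ⟨Mw, fun x hx => hMw _ (mem_closedBall_zero_iff.2 (hR x hx))⟩, hd⟩

theorem exists_quadratic_dissipation {s κ : ℝ} (hκ : κ ≤ 0) (hs : 0 < s) (R : ℝ) :
    ∃ l d : ℝ, 0 < d ∧ ∀ x p v : ℝ, x ^ 2 ≤ R ^ 2 →
      -s * p ^ 2 + (1 + 4 * l * κ) * (x * p * v) - 2 * l * v ^ 2 ≤ -d * (p ^ 2 + v ^ 2) := by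
  rcases hκ.eq_or_lt with h | h
  · refine ⟨(R ^ 2 / (2 * s) + s / 2) / 2, s / 2, by positivity, fun x p v hx => ?_⟩
    have e1 : R ^ 2 / (2 * s) * v ^ 2 - x * p * v + s / 2 * p ^ 2 =
        ((s * p - x * v) ^ 2 + (R ^ 2 - x ^ 2) * v ^ 2) / (2 * s) := by
      field_simp; ring
    have e2 : 0 ≤ ((s * p - x * v) ^ 2 + (R ^ 2 - x ^ 2) * v ^ 2) / (2 * s) := by
      have := sub_nonneg.2 hx
      positivity
    rw [h]
    linarith
  · refine ⟨-1 / (4 * κ), min s (-1 / (2 * κ)), lt_min hs (div_pos_of_neg_of_neg (by norm_num)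
      (by linarith)), fun x p v hx => ?_⟩
    have e1 : 1 + 4 * (-1 / (4 * κ)) * κ = 0 := by
      have := h.ne
      field_simp; ring
    have e2 : 2 * (-1 / (4 * κ)) = -1 / (2 * κ) := by
      have := h.ne
      field_simp; ring
    have m1 := min_le_left s (-1 / (2 * κ))
    have m2 := min_le_right s (-1 / (2 * κ))
    rw [e1, mul_div_assoc', ← mul_div_assoc', e2]
    nlinarith [sq_nonneg p, sq_nonneg v]

theorem sq_speed_le_dissipation {s κ R G x p g v d D l : ℝ} (hx : x ^ 2 ≤ R ^ 2)
    (hg : -|G| ≤ g) (hD0 : 0 ≤ D)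
    (hD : D * d = 1 + 2 * s ^ 2 + 4 * (s ^ 2 / 2 + |G| + 2 * R ^ 2 + 1))
    (hl : -s * p ^ 2 + (1 + 4 * l * κ) * (x * p * v) - 2 * l * v ^ 2 ≤ -d * (p ^ 2 + v ^ 2)) :
    p ^ 2 + (-s * p + x * g) ^ 2 + v ^ 2 ≤
      4 * (-s * p * (x * g) + (x * g) ^ 2 + p ^ 2 * g - x ^ 2 * p ^ 2 - x * p * v) -
        D * (-s * p ^ 2 + (1 + 4 * l * κ) * (x * p * v) - 2 * l * v ^ 2) := by
  have h1 := mul_le_mul_of_nonneg_left hl hD0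
  have h2 : D * (-d * (p ^ 2 + v ^ 2)) =
      -(1 + 2 * s ^ 2 + 4 * (s ^ 2 / 2 + |G| + 2 * R ^ 2 + 1)) * (p ^ 2 + v ^ 2) := by
    rw [← hD]; ring
  have h3 := mul_nonneg (neg_le_iff_add_nonneg.1 hg) (sq_nonneg p)
  have h4 := mul_nonneg (sub_nonneg.2 hx) (sq_nonneg p)
  have h5 := mul_nonneg (abs_nonneg G) (sq_nonneg v)
  have h6 := mul_nonneg (sq_nonneg R) (sq_nonneg v)
  have h7 := mul_nonneg (sq_nonneg s) (sq_nonneg v)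
  have h8 : p ^ 2 + (-s * p + x * g) ^ 2 + v ^ 2 ≤
      (1 + 2 * s ^ 2) * (p ^ 2 + v ^ 2) + 2 * (x * g) ^ 2 := by
    linarith [sq_nonneg (s * p + x * g)]
  have h9 : 2 * (x * g) ^ 2 - 4 * (s ^ 2 / 2 + |G| + 2 * R ^ 2 + 1) * (p ^ 2 + v ^ 2) ≤
      4 * (-s * p * (x * g) + (x * g) ^ 2 + p ^ 2 * g - x ^ 2 * p ^ 2 - x * p * v) := by
    linarith [sq_nonneg (s * p - x * g), sq_nonneg (x * p - v), sq_nonneg p, sq_nonneg v,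
      mul_nonneg (sq_nonneg R) (sq_nonneg p)]
  linarith

theorem exists_lyapunov_of_le_half {s τ r : ℝ} (hτ : τ ≤ 1/2) (hs : 0 < s) {U : ℝ → ℝ × ℝ × ℝ}
    (hU : ∀ x, 0 ≤ x → HasDerivAt U (vf (adaptedCoeffs s τ r 0 0) (U x)) x)
    (hR : ∃ R, ∀ x, 0 ≤ x → ‖U x‖ ≤ R) :
    ∃ H H' : ℝ → ℝ, (∃ M, ∀ x, 0 ≤ x → |H x| ≤ M) ∧ ∀ x, 0 ≤ x →
      HasDerivAt H (H' x) x ∧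
      dot (vf (adaptedCoeffs s τ r 0 0) (U x)) (vf (adaptedCoeffs s τ r 0 0) (U x)) ≤ H' x := by
  obtain ⟨R, hR⟩ := hR
  set κ := τ - 1/2 with hκ
  obtain ⟨G, hG⟩ := (isCompact_closedBall (0 : ℝ × ℝ × ℝ) R).exists_bound_of_continuousOn
    (f := fun q => r - q.1 ^ 2 / 2 - q.2.2) (by fun_prop)
  obtain ⟨l, d, hd, hl⟩ := exists_quadratic_dissipation (κ := κ) (by linarith) hs R
  set D := (1 + 2 * s ^ 2 + 4 * (s ^ 2 / 2 + |G| + 2 * R ^ 2 + 1)) / d with hD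
  have hDd : D * d = 1 + 2 * s ^ 2 + 4 * (s ^ 2 / 2 + |G| + 2 * R ^ 2 + 1) :=
    div_mul_cancel₀ _ hd.ne'
  set W : ℝ × ℝ × ℝ → ℝ := fun q => 4 * (q.2.1 * q.1 * (r - q.1 ^ 2 / 2 - q.2.2)) -
    D * (q.2.1 ^ 2 / 2 + q.1 ^ 4 * (1/8 + κ / 4) - r * q.1 ^ 2 / 2 +
      l * (κ * q.1 ^ 2 - q.2.2) ^ 2) with hW
  have hWc : Continuous W := by fun_prop
  obtain ⟨M, hM⟩ := (isCompact_closedBall (0 : ℝ × ℝ × ℝ) R).exists_bound_of_continuousOn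
    hWc.continuousOn
  refine ⟨fun x => W (U x), fun t => 4 * (-s * (U t).2.1 * ((U t).1 *
      (r - (U t).1 ^ 2 / 2 - (U t).2.2)) + ((U t).1 * (r - (U t).1 ^ 2 / 2 - (U t).2.2)) ^ 2 +
      (U t).2.1 ^ 2 * (r - (U t).1 ^ 2 / 2 - (U t).2.2) - (U t).1 ^ 2 * (U t).2.1 ^ 2 -
      (U t).1 * (U t).2.1 * (κ * (U t).1 ^ 2 - (U t).2.2)) -
    D * (-s * (U t).2.1 ^ 2 + (1 + 4 * l * κ) * ((U t).1 * (U t).2.1 *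
      (κ * (U t).1 ^ 2 - (U t).2.2)) - 2 * l * (κ * (U t).1 ^ 2 - (U t).2.2) ^ 2),
    ⟨M, fun x hx => hM _ (mem_closedBall_zero_iff.2 (hR x hx))⟩, fun t ht => ⟨?_, ?_⟩⟩
  · have h1 := (hU t ht).prod_fst
    have h2 := (hU t ht).prod_snd.prod_fst
    have h3 := (hU t ht).prod_snd.prod_snd
    have hg := ((h1.pow 2).div_const 2).const_sub r |>.sub h3
    have hv := ((h1.pow 2).const_mul κ).sub h3
    refine ((((h2.mul h1).mul hg).const_mul 4).sub ((((((h2.pow 2).div_const 2).add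
      ((h1.pow 4).mul_const (1/8 + κ / 4))).sub (((h1.pow 2).const_mul r).div_const 2)).add
      ((hv.pow 2).const_mul l)).const_mul D)).congr_deriv ?_
    simp only [Pi.sub_apply, Pi.mul_apply, Pi.pow_apply, vf, adaptedCoeffs, hκ]
    push_cast
    ring
  · have hGt := hG (U t) (mem_closedBall_zero_iff.2 (hR t ht))
    rw [Real.norm_eq_abs] at hGt
    have hx : |(U t).1| ≤ R := (norm_fst_le (U t)).trans (hR t ht)
    have hx2 : (U t).1 ^ 2 ≤ R ^ 2 := by
      rw [← sq_abs]; gcongr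
    refine le_of_eq_of_le ?_ (sq_speed_le_dissipation (κ := κ) hx2
      ((neg_le_neg (hGt.trans (le_abs_self G))).trans (neg_abs_le _)) (by positivity) hDd
      (hl _ _ _ hx2))
    simp only [dot, vf, adaptedCoeffs, hκ]
    ring

theorem tendsto_vf_zero {c : Coeffs ℝ} {U : ℝ → ℝ × ℝ × ℝ}
    (hU : ∀ x, 0 ≤ x → HasDerivAt U (vf c (U x)) x) (hR : ∃ R, ∀ x, 0 ≤ x → ‖U x‖ ≤ R)
    {t : ℝ} (ht : 0 ≤ t) {H H' : ℝ → ℝ} (hM : ∃ M, ∀ x, 0 ≤ x → |H x| ≤ M)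
    (hH : ∀ x, 0 ≤ x → HasDerivAt H (H' x) x ∧
      dot (vf c (U (x + t))) (vf c (U (x + t))) - 1/2 * dot (vf c (U x)) (vf c (U x)) ≤ H' x) :
    Tendsto (fun x => vf c (U x)) atTop (𝓝 0) := by
  obtain ⟨R, hR⟩ := hR
  obtain ⟨M, hM⟩ := hM
  set K := Metric.closedBall (0 : ℝ × ℝ × ℝ) R
  obtain ⟨L, hB⟩ := exists_vfBounds c (isCompact_closedBall (0 : ℝ × ℝ × ℝ) R)
  have hUK : ∀ x, 0 ≤ x → U x ∈ K := fun x hx => mem_closedBall_zero_iff.2 (hR x hx)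
  set P : ℝ → ℝ := fun x => dot (vf c (U (max x 0))) (vf c (U (max x 0))) with hP
  have hP0 : ∀ x, 0 ≤ P x := fun x => (sq_nonneg _).trans (sq_norm_le_dot_self _)
  have hPc : Continuous P := by
    have h1 : Continuous fun x => U (max x 0) := continuous_iff_continuousAt.2 fun x =>
      ContinuousAt.comp (f := fun x => max x 0) (hU _ (le_max_right x 0)).continuousAt
        (by fun_prop)
    have h2 : Continuous (vf c) := by unfold vf; fun_prop
    have h3 := h2.comp h1
    simp only [hP, dot]
    exact ((h3.fst.mul h3.fst).add (h3.snd.fst.mul h3.snd.fst)).add (h3.snd.snd.mul h3.snd.snd)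
  set J : ℝ → ℝ := fun T => ∫ x in (0 : ℝ)..T, P x with hJ
  have hJd : ∀ T, HasDerivAt J (P T) T := fun T => hPc.integral_hasStrictDerivAt 0 T |>.hasDerivAt
  have hJmono : Monotone J := monotone_of_hasDerivAt_nonneg hJd fun x => hP0 x
  have hJ0 : J 0 = 0 := intervalIntegral.integral_same
  have hGd : ∀ T, 0 ≤ T → HasDerivAt (fun T => H T - J (T + t) + 1/2 * J T)
      (H' T - P (T + t) + 1/2 * P T) T := fun T hT =>
    ((hH T hT).1.sub ((hJd (T + t)).comp_add_const T t)).add ((hJd T).const_mul (1/2))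
  have hGmono : MonotoneOn (fun T => H T - J (T + t) + 1/2 * J T) (Set.Ici 0) := by
    refine monotoneOn_of_deriv_nonneg (convex_Ici 0)
      (fun T hT => (hGd T hT).continuousAt.continuousWithinAt)
      (fun T hT => ?_) (fun T hT => ?_)
    · rw [interior_Ici] at hT
      exact (hGd T hT.le).differentiableAt.differentiableWithinAt
    · rw [interior_Ici] at hT
      have hT' : 0 ≤ T := le_of_lt hT
      rw [(hGd T hT').deriv]
      have := (hH T hT').2
      simp only [hP, max_eq_left hT', max_eq_left (add_nonneg hT' ht)]
      linarith
  have hbound : ∀ T, J T ≤ 2 * (2 * M + J t) := by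
    have hpos : ∀ T, 0 ≤ T → J T ≤ 2 * (2 * M + J t) := fun T hT => by
      have h1 := hGmono (Set.mem_Ici.2 le_rfl) (Set.mem_Ici.2 hT) hT
      simp only [zero_add, hJ0, mul_zero, add_zero] at h1
      have h2 := hJmono (le_add_of_nonneg_right ht : T ≤ T + t)
      have h3 := abs_le.1 (hM 0 le_rfl)
      have h4 := abs_le.1 (hM T hT)
      linarith [h3.1, h4.2]
    exact fun T => (hJmono (le_max_left T 0)).trans (hpos _ (le_max_right T 0))
  have hlim := tendsto_atTop_ciSup hJmono ⟨_, Set.forall_mem_range.2 hbound⟩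
  have hdiff : Tendsto (fun T => J T - J (T - 1)) atTop (𝓝 0) := by
    have := hlim.sub (hlim.comp (tendsto_atTop_add_const_right atTop (-1) tendsto_id))
    rw [sub_self] at this
    exact this
  have hsq : Tendsto (fun T => ‖vf c (U T)‖ ^ 2) atTop (𝓝 0) := by
    refine squeeze_zero' (Eventually.of_forall fun T => sq_nonneg _) ?_
      (by simpa using hdiff.const_mul (Real.exp L ^ 2))
    filter_upwards [eventually_ge_atTop 1] with T hT
    obtain ⟨x, hx, hxe⟩ := exists_hasDerivAt_eq_slope J P (sub_one_lt T)
      (fun x _ => (hJd x).continuousAt.continuousWithinAt) (fun x _ => hJd x)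
    rw [sub_sub_cancel, div_one] at hxe
    have hx0 : 0 ≤ x := by linarith [hx.1]
    have hL : 0 ≤ L := zero_le_one.trans hB.one_le
    have h1 := norm_vf_flow_le hB hU hUK hx0 hx.2.le
    have h2 : ‖vf c (U T)‖ ≤ Real.exp L * ‖vf c (U x)‖ := by
      refine h1.trans (mul_le_mul_of_nonneg_right (Real.exp_le_exp.2 ?_) (norm_nonneg _))
      nlinarith [hx.1]
    calc ‖vf c (U T)‖ ^ 2 ≤ (Real.exp L * ‖vf c (U x)‖) ^ 2 := by gcongr
      _ = Real.exp L ^ 2 * ‖vf c (U x)‖ ^ 2 := mul_pow _ _ _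
      _ ≤ Real.exp L ^ 2 * P x := by
        gcongr
        simp only [hP, max_eq_left hx0]
        exact sq_norm_le_dot_self _
      _ = _ := by rw [hxe]
  have := hsq.sqrt
  simp only [Real.sqrt_zero, Real.sqrt_sq (norm_nonneg _)] at this
  exact tendsto_zero_iff_norm_tendsto_zero.2 this

/-- If `g` tends to zero along a curve in a compact set, the curve approaches the zero set of `g`. -/
theorem IsCompact.tendsto_infDist_zeros {E F ι : Type*} [PseudoMetricSpace E]
    [NormedAddCommGroup F] {K : Set E} (hK : IsCompact K) {g : E → F} (hg : Continuous g)
    {l : Filter ι} {u : ι → E} (hu : ∀ᶠ i in l, u i ∈ K) (h0 : Tendsto (fun i => g (u i)) l (𝓝 0)) :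
    Tendsto (fun i => Metric.infDist (u i) {p | g p = 0}) l (𝓝 0) := by
  rw [Metric.tendsto_nhds]
  intro ε hε
  simp only [Real.dist_eq, sub_zero, abs_of_nonneg Metric.infDist_nonneg]
  set A := K ∩ {p | ε ≤ Metric.infDist p {p | g p = 0}}
  have hA : IsCompact A :=
    hK.inter_right (isClosed_le continuous_const (Metric.continuous_infDist_pt _))
  obtain ⟨δ, hδ, hmin⟩ : ∃ δ > 0, ∀ p ∈ A, δ ≤ ‖g p‖ := by
    rcases A.eq_empty_or_nonempty with h | h
    · exact ⟨1, one_pos, by simp [h]⟩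
    · obtain ⟨p, hp, hpm⟩ := hA.exists_isMinOn h hg.norm.continuousOn
      refine ⟨‖g p‖, norm_pos_iff.2 fun h => ?_, fun q hq => hpm hq⟩
      have := hp.2
      rw [Set.mem_ofPred_eq, Metric.infDist_zero_of_mem (by exact h)] at this
      linarith
  have h1 := (tendsto_zero_iff_norm_tendsto_zero.1 h0).eventually (gt_mem_nhds hδ)
  filter_upwards [hu, h1] with i hi hgi
  by_contra! hcon
  exact (hmin _ ⟨hi, hcon⟩).not_gt hgi

/-- The change of variables conjugating the Lorenz system to its normal form. -/
noncomputable def lorenzChart (σ β η a : ℝ) (q : ℝ × ℝ × ℝ) : ℝ × ℝ × ℝ :=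
  (q.1 / β, σ * (q.2.1 - q.1) / β ^ 2 + η * (q.1 / β), σ * q.2.2 / β ^ 2 + (a - 1/2) * (q.1 / β) ^ 2)

noncomputable abbrev lorenzCoeffs (σ ρ β η a : ℝ) : Coeffs ℝ :=
  adaptedCoeffs ((σ + 1) / β) (σ / β) (σ * (ρ - 1) / β ^ 2) η a

theorem hasDerivAt_lorenzChart {σ ρ β : ℝ} (hβ : β ≠ 0) (η a : ℝ) {u : ℝ → ℝ × ℝ × ℝ} {t : ℝ}
    (h : HasDerivAt u (lorenzRHS σ ρ β (u t)) t) :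
    HasDerivAt (fun t => lorenzChart σ β η a (u t))
      (β • vf (lorenzCoeffs σ ρ β η a) (lorenzChart σ β η a (u t))) t := by
  have h1 := h.prod_fst
  have h2 := h.prod_snd.prod_fst
  have h3 := h.prod_snd.prod_snd
  have g1 := h1.div_const β
  have g2 := (((h2.sub h1).const_mul σ).div_const (β ^ 2)).add (g1.const_mul η)
  have g3 := ((h3.const_mul σ).div_const (β ^ 2)).add ((g1.pow 2).const_mul (a - 1/2))
  refine (g1.prodMk (g2.prodMk g3)).congr_deriv ?_
  simp only [lorenzRHS, vf, adaptedCoeffs, lorenzChart, Prod.smul_mk, smul_eq_mul, Prod.mk.injEq]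
  push_cast
  refine ⟨?_, ?_, ?_⟩ <;> field_simp <;> ring

theorem lorenzRHS_eq {σ β : ℝ} (hσ : σ ≠ 0) (hβ : β ≠ 0) (ρ η a : ℝ) (q f : ℝ × ℝ × ℝ)
    (hf : f = vf (lorenzCoeffs σ ρ β η a) (lorenzChart σ β η a q)) :
    lorenzRHS σ ρ β q = (β ^ 2 * f.1, β ^ 2 * f.1 + β ^ 3 / σ * (f.2.1 - η * f.1),
      β ^ 3 / σ * f.2.2 - (2 * a - 1) * β ^ 2 / σ * (f.1 * q.1)) := by
  rw [hf]
  simp only [lorenzRHS, vf, adaptedCoeffs, lorenzChart, Prod.mk.injEq]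
  refine ⟨?_, ?_, ?_⟩ <;> field_simp <;> ring

theorem exists_tendsto_vf_zero {s τ r : ℝ} (hτ : 0 < τ) (hs : τ < s) (hr : r < 1 + s) :
    ∃ η a, ∀ U : ℝ → ℝ × ℝ × ℝ,
      (∀ x, 0 ≤ x → HasDerivAt U (vf (adaptedCoeffs s τ r η a) (U x)) x) →
      (∃ R, ∀ x, 0 ≤ x → ‖U x‖ ≤ R) →
      Tendsto (fun x => vf (adaptedCoeffs s τ r η a) (U x)) atTop (𝓝 0) := by
  rcases le_or_gt τ (1/2) with h | h
  · refine ⟨0, 0, fun U hU hR => ?_⟩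
    obtain ⟨H, H', hM, hH⟩ := exists_lyapunov_of_le_half h (hτ.trans hs) hU hR
    refine tendsto_vf_zero hU hR le_rfl hM fun x hx => ⟨(hH x hx).1, le_trans ?_ (hH x hx).2⟩
    rw [add_zero]
    linarith [(sq_nonneg _).trans (sq_norm_le_dot_self (vf (adaptedCoeffs s τ r 0 0) (U x)))]
  · obtain ⟨η, a, hmem⟩ := exists_memory_lyapunov h hs hr
    refine ⟨η, a, fun U hU hR => ?_⟩
    obtain ⟨t, ht, H, H', hM, hH⟩ := hmem U hU hR
    exact tendsto_vf_zero hU hR ht hM hH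

theorem tendsto_lorenzRHS_zero {σ ρ β : ℝ} (hσ : 0 < σ) (hβ : 0 < β)
    (hρ : ρ < (β + 1) * (β / σ + 1)) {u : ℝ → ℝ × ℝ × ℝ}
    (hsol : ∀ t, 0 < t → HasDerivAt u (lorenzRHS σ ρ β (u t)) t)
    {R : ℝ} (hR : ∀ t, 0 ≤ t → ‖u t‖ ≤ R) :
    Tendsto (fun t => lorenzRHS σ ρ β (u t)) atTop (𝓝 0) := by
  have hr : σ * (ρ - 1) / β ^ 2 < 1 + (σ + 1) / β := by
    rw [div_lt_iff₀ (by positivity)]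
    have h1 := mul_lt_mul_of_pos_left hρ hσ
    have e1 : σ * ((β + 1) * (β / σ + 1)) = (β + 1) * (β + σ) := by field_simp
    have e2 : (1 + (σ + 1) / β) * β ^ 2 = β ^ 2 + (σ + 1) * β := by field_simp
    linarith
  obtain ⟨η, a, hconv⟩ := exists_tendsto_vf_zero (s := (σ + 1) / β) (τ := σ / β)
    (div_pos hσ hβ) (by gcongr; linarith) hr
  have htime : ∀ x, 0 ≤ x → 0 < (x + 1) / β := fun x hx => by positivity
  have hlim := hconv (fun x => lorenzChart σ β η a (u ((x + 1) / β)))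
    (fun x hx => by
      have h1 := hasDerivAt_lorenzChart hβ.ne' η a (hsol _ (htime x hx))
      have h2 := h1.scomp x (((hasDerivAt_id x).add_const 1).div_const β)
      rw [smul_smul, one_div_mul_cancel hβ.ne', one_smul] at h2
      exact h2)
    (by
      have hc : Continuous (lorenzChart σ β η a) := by unfold lorenzChart; fun_prop
      obtain ⟨M, hM⟩ := (isCompact_closedBall (0 : ℝ × ℝ × ℝ) R).exists_bound_of_continuousOn
        hc.continuousOn
      exact ⟨M, fun x hx => hM _ (mem_closedBall_zero_iff.2 (hR _ (htime x hx).le))⟩)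
  have hshift : Tendsto (fun t => β * t - 1) atTop atTop :=
    tendsto_atTop_add_const_right _ _ (tendsto_id.const_mul_atTop hβ)
  have hlim' := hlim.comp hshift
  set f : ℝ → ℝ × ℝ × ℝ := fun t => vf (lorenzCoeffs σ ρ β η a) (lorenzChart σ β η a (u t)) with hf
  have hf0 : Tendsto f atTop (𝓝 0) := by
    refine hlim'.congr fun t => ?_
    have e : (β * t - 1 + 1) / β = t := by rw [sub_add_cancel, mul_div_cancel_left₀ _ hβ.ne']
    simp only [Function.comp_apply, e, hf]
  have h1 : Tendsto (fun t => (f t).1) atTop (𝓝 0) := (continuous_fst.tendsto _).comp hf0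
  have h2 : Tendsto (fun t => (f t).2.1) atTop (𝓝 0) :=
    ((continuous_fst.comp continuous_snd).tendsto _).comp hf0
  have h3 : Tendsto (fun t => (f t).2.2) atTop (𝓝 0) :=
    ((continuous_snd.comp continuous_snd).tendsto _).comp hf0
  have h4 : Tendsto (fun t => (f t).1 * (u t).1) atTop (𝓝 0) :=
    h1.zero_mul_isBoundedUnder_le ⟨R, eventually_map.2 ((eventually_ge_atTop 0).mono
      fun t ht => (norm_fst_le (u t)).trans (hR t ht))⟩
  have key := (h1.const_mul (β ^ 2)).prodMk_nhds
    (((h1.const_mul (β ^ 2)).add ((h2.sub (h1.const_mul η)).const_mul (β ^ 3 / σ))).prodMk_nhds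
      ((h3.const_mul (β ^ 3 / σ)).sub (h4.const_mul ((2 * a - 1) * β ^ 2 / σ))))
  simp only [mul_zero, add_zero, sub_zero] at key
  exact key.congr fun t => (lorenzRHS_eq hσ.ne' hβ.ne' ρ η a (u t) (f t) rfl).symm

/-- for `σ, β > 0` and `0 < ρ < (β + 1)(β/σ + 1)`, every bounded solution of the
Lorenz system on `[0, ∞)` tends to the set of equilibria as `t → +∞`. -/
theorem lorenz_bounded_solutions_tend_to_stationary_set
    (σ ρ β : ℝ) (hσ : 0 < σ) (hβ : 0 < β) (hρ : 0 < ρ)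
    (hρ' : ρ < (β + 1) * (β / σ + 1))
    (u : ℝ → ℝ × ℝ × ℝ)
    (hsol : ∀ t : ℝ, 0 ≤ t → HasDerivWithinAt u (lorenzRHS σ ρ β (u t)) (Set.Ici 0) t)
    (hbdd : Bornology.IsBounded (u '' Set.Ici 0)) :
    Tendsto (fun t : ℝ => Metric.infDist (u t) {p : ℝ × ℝ × ℝ | lorenzRHS σ ρ β p = 0})
      atTop (nhds 0) := by
  obtain ⟨R, hR⟩ := hbdd.exists_norm_le
  have hR' : ∀ t, 0 ≤ t → ‖u t‖ ≤ R := fun t ht => hR _ ⟨t, ht, rfl⟩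
  exact (isCompact_closedBall (0 : ℝ × ℝ × ℝ) R).tendsto_infDist_zeros
    (by unfold lorenzRHS; fun_prop)
    ((eventually_ge_atTop 0).mono fun t ht => mem_closedBall_zero_iff.2 (hR' t ht))
    (tendsto_lorenzRHS_zero hσ hβ hρ'
      (fun t ht => (hsol t ht.le).hasDerivAt (Ici_mem_nhds ht)) hR')
end

section
/- Let a, b ∈ ℝ, c ≠ 0, and let (x, y, z) : ℝ → ℝ³ be a solution of the Chen system with parameters (a, b, c). Then the functions X(τ) = −x(−τ/c)/c, Y(τ) = −y(−τ/c)/c, Z(τ) = −z(−τ/c)/c form a solution of the Lorenz system with parameters σ = −a/c, ρ = a/c − 1, β = −b/c. (Note that this change of variables reverses the direction of time when c > 0, and the resulting parameters satisfy σ + ρ = −1.) -/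
theorem HasDerivAt.neg_comp_neg_div_div {f : ℝ → ℝ} {f' c τ : ℝ}
    (hf : HasDerivAt f f' (-τ / c)) :
    HasDerivAt (fun s => -f (-s / c) / c) (f' / c ^ 2) τ := by
  have hs : HasDerivAt (fun s : ℝ => -s / c) (-1 / c) τ := (hasDerivAt_id τ).neg.div_const c
  have h : HasDerivAt (fun s => -f (-s / c) / c) (-(f' * (-1 / c)) / c) τ :=
    (hf.comp τ hs).neg.div_const c
  convert h using 1
  ring

/-- if `c ≠ 0` and `(x, y, z)` solves the Chen system with parameters `(a, b, c)`
(`ẋ = a(y − x), ẏ = (c − a)x + cy − xz, ż = −bz + xy`), then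
`X(τ) = −x(−τ/c)/c, Y(τ) = −y(−τ/c)/c, Z(τ) = −z(−τ/c)/c` solve the Lorenz system
(`Ẋ = σ(Y − X), Ẏ = ρX − Y − XZ, Ż = −βZ + XY`) with parameters
`σ = −a/c, ρ = a/c − 1, β = −b/c`. -/
theorem chen_to_lorenz (a b c : ℝ) (hc : c ≠ 0) (x y z : ℝ → ℝ)
    (hx : ∀ t : ℝ, HasDerivAt x (a * (y t - x t)) t)
    (hy : ∀ t : ℝ, HasDerivAt y ((c - a) * x t + c * y t - x t * z t) t)
    (hz : ∀ t : ℝ, HasDerivAt z (-b * z t + x t * y t) t) :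
    (∀ τ : ℝ, HasDerivAt (fun s => -x (-s / c) / c)
      ((-a / c) * (-y (-τ / c) / c - -x (-τ / c) / c)) τ) ∧
    (∀ τ : ℝ, HasDerivAt (fun s => -y (-s / c) / c)
      ((a / c - 1) * (-x (-τ / c) / c) - -y (-τ / c) / c -
        (-x (-τ / c) / c) * (-z (-τ / c) / c)) τ) ∧
    (∀ τ : ℝ, HasDerivAt (fun s => -z (-s / c) / c)
      (-(-b / c) * (-z (-τ / c) / c) + (-x (-τ / c) / c) * (-y (-τ / c) / c)) τ) := by
  refine ⟨fun τ => ?_, fun τ => ?_, fun τ => ?_⟩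
  · convert (hx (-τ / c)).neg_comp_neg_div_div using 1
    field_simp
    ring
  · convert (hy (-τ / c)).neg_comp_neg_div_div using 1
    field_simp
    ring
  · convert (hz (-τ / c)).neg_comp_neg_div_div using 1
    field_simp
end

section
/- Let a, b ∈ ℝ, c ≠ 0, and let (x, y, z) : ℝ → ℝ³ be a solution of the Lu system with parameters (a, b, c). Then the functions X(τ) = −x(−τ/c)/c, Y(τ) = −y(−τ/c)/c, Z(τ) = −z(−τ/c)/c form a solution of the Lorenz system with parameters σ = −a/c, ρ = 0, β = −b/c. (Note that this change of variables reverses the direction of time when c > 0.) -/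
/-- if `c ≠ 0` and `(x, y, z)` solves the Lu system with parameters `(a, b, c)`
(`ẋ = a(y − x), ẏ = cy − xz, ż = −bz + xy`), then
`X(τ) = −x(−τ/c)/c, Y(τ) = −y(−τ/c)/c, Z(τ) = −z(−τ/c)/c` solve the Lorenz system
(`Ẋ = σ(Y − X), Ẏ = ρX − Y − XZ, Ż = −βZ + XY`) with parameters
`σ = −a/c, ρ = 0, β = −b/c`. -/
theorem lu_to_lorenz (a b c : ℝ) (hc : c ≠ 0) (x y z : ℝ → ℝ)
    (hx : ∀ t : ℝ, HasDerivAt x (a * (y t - x t)) t)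
    (hy : ∀ t : ℝ, HasDerivAt y (c * y t - x t * z t) t)
    (hz : ∀ t : ℝ, HasDerivAt z (-b * z t + x t * y t) t) :
    (∀ τ : ℝ, HasDerivAt (fun s => -x (-s / c) / c)
      ((-a / c) * (-y (-τ / c) / c - -x (-τ / c) / c)) τ) ∧
    (∀ τ : ℝ, HasDerivAt (fun s => -y (-s / c) / c)
      ((0 : ℝ) * (-x (-τ / c) / c) - -y (-τ / c) / c -
        (-x (-τ / c) / c) * (-z (-τ / c) / c)) τ) ∧
    (∀ τ : ℝ, HasDerivAt (fun s => -z (-s / c) / c)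
      (-(-b / c) * (-z (-τ / c) / c) + (-x (-τ / c) / c) * (-y (-τ / c) / c)) τ) := by
  refine ⟨fun τ => ?_, fun τ => ?_, fun τ => ?_⟩
  · convert (hx (-τ / c)).neg_comp_neg_div_div using 1
    ring
  · convert (hy (-τ / c)).neg_comp_neg_div_div using 1
    field_simp
    ring
  · convert (hz (-τ / c)).neg_comp_neg_div_div using 1
    ring
end

section
/- Let a > 0, b ∈ ℝ, and let (x, y, z) : ℝ → ℝ³ be a solution of the Chen system with parameters (a, b, 0). Then the functions X(t) = x(t)/√a, Y(t) = y(t)/√a, Z(t) = z(t)/a form a solution of the T-system with parameters (a, b, 0). -/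
/-- if `a > 0` and `(x, y, z)` solves the Chen system with parameters `(a, b, 0)`
(`ẋ = a(y − x), ẏ = (0 − a)x + 0·y − xz, ż = −bz + xy`), then
`X(t) = x(t)/√a, Y(t) = y(t)/√a, Z(t) = z(t)/a` solve the T-system with parameters `(a, b, 0)`
(`Ẋ = a(Y − X), Ẏ = (0 − a)X − aXZ, Ż = −bZ + XY`). -/
theorem chen_to_T_system (a b : ℝ) (ha : 0 < a) (x y z : ℝ → ℝ)
    (hx : ∀ t : ℝ, HasDerivAt x (a * (y t - x t)) t)
    (hy : ∀ t : ℝ, HasDerivAt y ((0 - a) * x t + 0 * y t - x t * z t) t)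
    (hz : ∀ t : ℝ, HasDerivAt z (-b * z t + x t * y t) t) :
    (∀ t : ℝ, HasDerivAt (fun s => x s / Real.sqrt a)
      (a * (y t / Real.sqrt a - x t / Real.sqrt a)) t) ∧
    (∀ t : ℝ, HasDerivAt (fun s => y s / Real.sqrt a)
      ((0 - a) * (x t / Real.sqrt a) - a * (x t / Real.sqrt a) * (z t / a)) t) ∧
    (∀ t : ℝ, HasDerivAt (fun s => z s / a)
      (-b * (z t / a) + (x t / Real.sqrt a) * (y t / Real.sqrt a)) t) := by
  refine ⟨fun t => ?_, fun t => ?_, fun t => ?_⟩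
  · refine ((hx t).div_const (Real.sqrt a)).congr_deriv ?_
    ring
  · refine ((hy t).div_const (Real.sqrt a)).congr_deriv ?_
    field_simp
    ring
  · refine ((hz t).div_const a).congr_deriv ?_
    rw [div_mul_div_comm, Real.mul_self_sqrt ha.le]
    ring
end

section
/- Let f : ℝⁿ → ℝⁿ be continuously differentiable with div f(x) = trace(Df(x)) ≥ d for all x ∈ ℝⁿ, where d > 0 is a constant. Let B ⊆ ℝⁿ be a bounded measurable set, and suppose there is a map φ : [0, ∞) × ℝⁿ → ℝⁿ such that for every x ∈ B: φ(0, x) = x and ∂φ/∂t(t, x) = f(φ(t, x)) for all t ≥ 0, and φ(t, ·) maps B into B for every t ≥ 0 (i.e. B is positively invariant). Then the n-dimensional Lebesgue measure of B equals zero. In particular, a system with everywhere positive constant divergence (such as the time-reversed Chen or Lu system with a + b > c, c > 0) has no bounded positively invariant set of positive volume and is not dissipative in the sense of Levinson. -/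
open Filter Topology

/-- The Jacobian matrix of a vector field `f : ℝⁿ → ℝⁿ` at a point `x`:
`(Df(x))ᵢⱼ = ∂fᵢ/∂xⱼ (x)`. -/
noncomputable def jacobian {n : ℕ}
    (f : EuclideanSpace ℝ (Fin n) → EuclideanSpace ℝ (Fin n))
    (x : EuclideanSpace ℝ (Fin n)) : Matrix (Fin n) (Fin n) ℝ :=
  Matrix.of fun i j => fderiv ℝ f x (EuclideanSpace.single j 1) i

open Set MeasureTheory Metric
open scoped NNReal ENNReal

section Determinant

variable {E : Type*} [NormedAddCommGroup E] [NormedSpace ℝ E] [FiniteDimensional ℝ E]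

theorem ContinuousLinearMap.differentiable_det :
    Differentiable ℝ fun A : E →L[ℝ] E => A.det := by
  let b := Module.finBasis ℝ E
  have hentry (i j) :
      Differentiable ℝ fun A : E →L[ℝ] E => LinearMap.toMatrix b b (A : E →ₗ[ℝ] E) i j := by
    simp only [LinearMap.toMatrix_apply]
    have := (LinearMap.toContinuousLinearMap (b.coord i)).differentiable.comp
      (ContinuousLinearMap.apply ℝ E (b j)).differentiable
    simpa [Function.comp_def] using this
  have hdet : (fun A : E →L[ℝ] E => A.det) =
      fun A : E →L[ℝ] E => (LinearMap.toMatrix b b (A : E →ₗ[ℝ] E)).det := by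
    ext A
    exact (LinearMap.det_toMatrix b (A : E →ₗ[ℝ] E)).symm
  rw [hdet]
  simp only [Matrix.det_apply']
  fun_prop

theorem ContinuousLinearMap.hasDerivAt_det_one_add_smul (A : E →L[ℝ] E) :
    HasDerivAt (fun r : ℝ => (1 + r • A).det) (LinearMap.trace ℝ E A) 0 := by
  let b := Module.finBasis ℝ E
  let M := LinearMap.toMatrix b b (A : E →ₗ[ℝ] E)
  let p := Matrix.det (1 + (Polynomial.X : Polynomial ℝ) • M.map Polynomial.C)
  have hp : (fun r : ℝ => (1 + r • A).det) = fun r => p.eval r := by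
    ext r
    have : (1 + r • A).det = (1 + r • M).det := by
      change LinearMap.det ((1 + r • A : E →L[ℝ] E) : E →ₗ[ℝ] E) = _
      rw [← LinearMap.det_toMatrix b]
      simp [M, LinearMap.toMatrix_one]
    rw [this]
    simp [p, eval_det, ← Matrix.smul_eq_mul_diagonal]
  rw [hp, LinearMap.trace_eq_matrix_trace ℝ b, ← Matrix.derivative_det_one_add_X_smul]
  exact p.hasDerivAt 0

/-- First-order lower bound for `det (1 + h A)`, uniform over bounded sets of operators. -/
theorem ContinuousLinearMap.eventually_one_add_mul_le_det_one_add_smul (L : ℝ) {d d' : ℝ}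
    (hd : d' < d) :
    ∀ᶠ h in 𝓝[>] (0 : ℝ), ∀ A : E →L[ℝ] E, ‖A‖ ≤ L → d ≤ LinearMap.trace ℝ E A →
      1 + h * d' ≤ (1 + h • A).det := by
  have hD := (differentiable_det (E := E) 1).hasFDerivAt
  have htrace (A : E →L[ℝ] E) :
      fderiv ℝ (fun A : E →L[ℝ] E => A.det) 1 A = LinearMap.trace ℝ E A := by
    refine HasDerivAt.unique ?_ (hasDerivAt_det_one_add_smul A)
    have hline : HasDerivAt (fun r : ℝ => 1 + r • A) A 0 := by
      simpa using ((hasDerivAt_id (0 : ℝ)).smul_const A).const_add 1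
    exact HasFDerivAt.comp_hasDerivAt (x := (0 : ℝ)) (by simpa using hD) hline
  set ε := (d - d') / (|L| + 1) with hε
  have hεpos : 0 < ε := by have := sub_pos.2 hd; positivity
  have hεL : ε * (|L| + 1) = d - d' := by rw [hε]; field_simp
  have hlittle := hD.isLittleO.def hεpos
  obtain ⟨δ, hδ, hball⟩ := Metric.eventually_nhds_iff.1 hlittle
  filter_upwards [Ioo_mem_nhdsGT (show 0 < δ / (|L| + 1) by positivity)] with h hh A hA htr
  have hhδ : h * (|L| + 1) < δ := (lt_div_iff₀ (by positivity)).1 hh.2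
  have hn : ‖h • A‖ ≤ h * (|L| + 1) := by
    rw [norm_smul, Real.norm_of_nonneg hh.1.le]
    gcongr
    · exact hh.1.le
    · linarith [le_abs_self L]
  have := hball (y := 1 + h • A) (by simpa [dist_eq_norm] using hn.trans_lt hhδ)
  rw [add_sub_cancel_left, map_smul, htrace, smul_eq_mul, Real.norm_eq_abs] at this
  have h1 := (abs_le.1 this).1
  have h2 : (1 : E →L[ℝ] E).det = 1 := by
    change LinearMap.det (1 : E →ₗ[ℝ] E) = 1
    simp
  have h3 := mul_le_mul_of_nonneg_left hn hεpos.le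
  have h4 := mul_le_mul_of_nonneg_left htr hh.1.le
  have h5 : ε * (h * (|L| + 1)) = h * (d - d') := by rw [← hεL]; ring
  linarith

end Determinant

section Flow

variable {E : Type*} [NormedAddCommGroup E] [NormedSpace ℝ E] {f : E → E} {K : Set E}

/-- If `Df` oscillates by at most `η` at scale `δ`, second differences of `f` between nearby pairs
of points are controlled. -/
theorem Convex.norm_sub_sub_sub_le {F : Type*} [NormedAddCommGroup F] [NormedSpace ℝ F]
    {f : E → F} (hK : Convex ℝ K) (hf : Differentiable ℝ f) {L η δ : ℝ}
    (hL : ∀ p ∈ K, ‖fderiv ℝ f p‖ ≤ L)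
    (hη : ∀ p ∈ K, ∀ q ∈ K, dist p q < δ → ‖fderiv ℝ f p - fderiv ℝ f q‖ ≤ η)
    {x y x' y' : E} (hx : x ∈ K) (hy : y ∈ K) (hx' : x' ∈ K) (hy' : y' ∈ K)
    (hxx' : dist x' x < δ) (hyy' : dist y' y < δ) :
    ‖(f x' - f y') - (f x - f y)‖ ≤ η * ‖x - y‖ + L * ‖(x' - y') - (x - y)‖ := by
  let p (t : ℝ) : E := y + t • (x - y)
  let q (t : ℝ) : E := y' + t • (x' - y')
  have hline (u v : E) (t : ℝ) : HasDerivAt (fun t : ℝ => u + t • v) v t := by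
    simpa using ((hasDerivAt_id t).smul_const v).const_add u
  have hderiv (t : ℝ) : HasDerivAt (fun t => f (q t) - f (p t))
      (fderiv ℝ f (q t) (x' - y') - fderiv ℝ f (p t) (x - y)) t :=
    ((hf _).hasFDerivAt.comp_hasDerivAt t (hline y' (x' - y') t)).sub
      ((hf _).hasFDerivAt.comp_hasDerivAt t (hline y (x - y) t))
  have hbound : ∀ t ∈ Ico (0 : ℝ) 1,
      ‖fderiv ℝ f (q t) (x' - y') - fderiv ℝ f (p t) (x - y)‖ ≤
        η * ‖x - y‖ + L * ‖(x' - y') - (x - y)‖ := by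
    intro t ht
    have htI : t ∈ Icc (0 : ℝ) 1 := ⟨ht.1, ht.2.le⟩
    have hp : p t ∈ K := hK.add_smul_sub_mem hy hx htI
    have hq : q t ∈ K := hK.add_smul_sub_mem hy' hx' htI
    have hqp : dist (q t) (p t) < δ := by
      have : q t - p t ∈ ball (0 : E) δ := by
        have := (convex_ball (0 : E) δ).add_smul_sub_mem (x := y' - y) (y := x' - x)
          (by simpa [dist_eq_norm] using hyy') (by simpa [dist_eq_norm] using hxx') htI
        convert this using 1
        simp only [p, q, smul_sub]
        abel
      simpa [dist_eq_norm] using this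
    have hsplit : fderiv ℝ f (q t) (x' - y') - fderiv ℝ f (p t) (x - y) =
        (fderiv ℝ f (q t) - fderiv ℝ f (p t)) (x - y) +
          fderiv ℝ f (q t) ((x' - y') - (x - y)) := by
      simp only [_root_.sub_apply, map_sub]
      abel
    rw [hsplit]
    refine (norm_add_le _ _).trans (add_le_add ?_ ?_)
    · exact ContinuousLinearMap.le_of_opNorm_le _ (hη _ hq _ hp hqp) _
    · exact ContinuousLinearMap.le_of_opNorm_le _ (hL _ hq) _
  have := norm_image_sub_le_of_norm_deriv_le_segment_01'
    (fun t _ => (hderiv t).hasDerivWithinAt) hbound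
  convert this using 2
  simp only [p, q, one_smul, zero_smul, add_zero, add_sub_cancel]
  abel

/-- Over short times, the difference of two trajectories of a `C¹` vector field in a compact convex
set dominates, up to a factor `1 + ε h`, the difference of the corresponding Euler steps. -/
theorem eventually_norm_euler_sub_le (hf : ContDiff ℝ 1 f) (hK : Convex ℝ K) (hKc : IsCompact K)
    {ε : ℝ} (hε : 0 < ε) :
    ∀ᶠ h in 𝓝[>] (0 : ℝ), ∀ u v : ℝ → E,
      (∀ t ∈ Icc 0 h, u t ∈ K ∧ HasDerivWithinAt u (f (u t)) (Ici 0) t) →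
      (∀ t ∈ Icc 0 h, v t ∈ K ∧ HasDerivWithinAt v (f (v t)) (Ici 0) t) →
      ‖(u 0 + h • f (u 0)) - (v 0 + h • f (v 0))‖ ≤ (1 + ε * h) * ‖u h - v h‖ := by
  have hdf : Differentiable ℝ f := hf.differentiable (by norm_num)
  have hcf' : Continuous (fderiv ℝ f) := hf.continuous_fderiv (by norm_num)
  obtain ⟨L₀, hL₀⟩ := hKc.exists_bound_of_continuousOn hcf'.continuousOn
  obtain ⟨M₀, hM₀⟩ := hKc.exists_bound_of_continuousOn hf.continuous.continuousOn
  set L := |L₀| + 1 with hLdef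
  set M := |M₀| + 1 with hMdef
  have hL : ∀ p ∈ K, ‖fderiv ℝ f p‖ ≤ L := fun p hp => by
    linarith [hL₀ p hp, le_abs_self L₀]
  have hM : ∀ p ∈ K, ‖f p‖ ≤ M := fun p hp => by
    linarith [hM₀ p hp, le_abs_self M₀]
  have hLpos : 0 < L := by positivity
  have hMpos : 0 < M := by positivity
  obtain ⟨δ, hδ, huc⟩ := Metric.uniformContinuousOn_iff_le.1
    (hKc.uniformContinuousOn_of_continuous hcf'.continuousOn) (ε / 4) (by positivity)
  have hη : ∀ p ∈ K, ∀ q ∈ K, dist p q < δ → ‖fderiv ℝ f p - fderiv ℝ f q‖ ≤ ε / 4 :=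
    fun p hp q hq hpq => by simpa [dist_eq_norm] using huc p hp q hq hpq.le
  have hsmall : ∀ᶠ h in 𝓝[>] (0 : ℝ),
      0 < h ∧ M * h < δ ∧ 6 * L * h < 1 ∧ 3 * L ^ 2 * h < ε / 4 := by
    have hlim (c : ℝ) : Tendsto (fun h : ℝ => c * h) (𝓝[>] 0) (𝓝 0) := by
      simpa using ((continuous_const_mul c).tendsto 0).mono_left nhdsWithin_le_nhds
    filter_upwards [self_mem_nhdsWithin, (hlim M).eventually_lt_const hδ,
      (hlim (6 * L)).eventually_lt_const one_pos,
      (hlim (3 * L ^ 2)).eventually_lt_const (show 0 < ε / 4 by positivity)] with h h1 h2 h3 h4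
    exact ⟨h1, h2, h3, h4⟩
  filter_upwards [hsmall] with h ⟨hh, hMh, hLh, hLh'⟩ u v hu hv
  have hIcc {w : ℝ → E} {w' : E} {t : ℝ} (hw : HasDerivWithinAt w w' (Ici 0) t) :
      HasDerivWithinAt w w' (Icc 0 h) t := hw.mono Icc_subset_Ici_self
  have hlip : LipschitzOnWith ⟨L, hLpos.le⟩ f K :=
    hK.lipschitzOnWith_of_nnnorm_fderiv_le (fun p _ => hdf p) fun p hp => hL p hp
  have h0 : (0 : ℝ) ∈ Icc 0 h := left_mem_Icc.2 hh.le
  have hend : h ∈ Icc 0 h := right_mem_Icc.2 hh.le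
  have hstay {w : ℝ → E} (hw : ∀ t ∈ Icc 0 h, w t ∈ K ∧ HasDerivWithinAt w (f (w t)) (Ici 0) t)
      (t : ℝ) (ht : t ∈ Icc 0 h) : dist (w t) (w 0) < δ := by
    have := norm_image_sub_le_of_norm_deriv_le_segment' (fun s hs => hIcc (hw s hs).2)
      (fun s hs => hM _ (hw s (Ico_subset_Icc_self hs)).1) t ht
    rw [dist_eq_norm]
    nlinarith [ht.2]
  set D := ‖u 0 - v 0‖ with hD
  have hgron : ∀ t ∈ Icc 0 h, ‖u t - v t‖ ≤ 3 * D := by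
    intro t ht
    have hIci {w : ℝ → E} (hw : ∀ t ∈ Icc 0 h, w t ∈ K ∧ HasDerivWithinAt w (f (w t)) (Ici 0) t)
        (s : ℝ) (hs : s ∈ Ico 0 h) : HasDerivWithinAt w (f (w s)) (Ici s) s :=
      (hw s (Ico_subset_Icc_self hs)).2.mono (Ici_subset_Ici.2 hs.1)
    have := dist_le_of_trajectories_ODE_of_mem (v := fun _ => f) (s := fun _ => K)
      (fun _ _ => hlip) (fun s hs => (hIcc (hu s hs).2).continuousWithinAt) (hIci hu)
      (fun s hs => (hu s (Ico_subset_Icc_self hs)).1)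
      (fun s hs => (hIcc (hv s hs).2).continuousWithinAt) (hIci hv)
      (fun s hs => (hv s (Ico_subset_Icc_self hs)).1) le_rfl t ht
    rw [dist_eq_norm, dist_eq_norm, sub_zero] at this
    have hexp : Real.exp (L * t) ≤ 3 := by
      have : L * t ≤ 1 := by nlinarith [ht.2, ht.1]
      linarith [Real.exp_le_exp.2 this, Real.exp_one_lt_d9]
    calc ‖u t - v t‖ ≤ D * Real.exp (L * t) := this
      _ ≤ D * 3 := by gcongr
      _ = 3 * D := mul_comm _ _
  have hdrift : ∀ t ∈ Icc 0 h, ‖(u t - v t) - (u 0 - v 0)‖ ≤ 3 * L * h * D := by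
    intro t ht
    have := norm_image_sub_le_of_norm_deriv_le_segment' (f := fun s => u s - v s)
      (C := 3 * L * D) (fun s hs => (hIcc (hu s hs).2).sub (hIcc (hv s hs).2))
      (fun s hs => by
        have hs' := Ico_subset_Icc_self hs
        have h1 := hlip.dist_le_mul _ (hu s hs').1 _ (hv s hs').1
        rw [dist_eq_norm, dist_eq_norm] at h1
        calc ‖f (u s) - f (v s)‖ ≤ L * ‖u s - v s‖ := h1
          _ ≤ L * (3 * D) := by gcongr; exact hgron s hs'
          _ = 3 * L * D := by ring) t ht
    calc _ ≤ 3 * L * D * (t - 0) := this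
      _ ≤ 3 * L * D * h := by gcongr; linarith [ht.2]
      _ = 3 * L * h * D := by ring
  have hrem : ‖(u h - v h) - ((u 0 + h • f (u 0)) - (v 0 + h • f (v 0)))‖ ≤ ε / 2 * D * h := by
    have := norm_image_sub_le_of_norm_deriv_le_segment'
      (f := fun s => (u s - v s) - s • (f (u 0) - f (v 0))) (C := ε / 2 * D)
      (fun s hs => ((hIcc (hu s hs).2).sub (hIcc (hv s hs).2)).sub
        ((hasDerivAt_id s).smul_const (f (u 0) - f (v 0))).hasDerivWithinAt)
      (fun s hs => by
        have hs' := Ico_subset_Icc_self hs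
        have h1 := hK.norm_sub_sub_sub_le hdf hL hη (hu 0 h0).1 (hv 0 h0).1 (hu s hs').1
          (hv s hs').1 (hstay hu s hs') (hstay hv s hs')
        rw [one_smul]
        calc _ ≤ _ := h1
          _ ≤ ε / 4 * D + L * (3 * L * h * D) := by gcongr; exact hdrift s hs'
          _ = (ε / 4 + 3 * L ^ 2 * h) * D := by ring
          _ ≤ (ε / 4 + ε / 4) * D := by gcongr
          _ = ε / 2 * D := by ring) h hend
    convert this using 2
    · simp only [zero_smul, sub_zero, smul_sub]
      abel
    · ring
  have hDle : D ≤ 2 * ‖u h - v h‖ := by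
    have h1 := hdrift h hend
    have h2 : D ≤ ‖u h - v h‖ + ‖(u h - v h) - (u 0 - v 0)‖ := by
      rw [hD, norm_sub_rev (u h - v h)]
      exact norm_le_insert' _ _
    nlinarith [norm_nonneg (u 0 - v 0)]
  have hE : ‖(u 0 + h • f (u 0)) - (v 0 + h • f (v 0))‖ ≤ ‖u h - v h‖ +
      ‖(u h - v h) - ((u 0 + h • f (u 0)) - (v 0 + h • f (v 0)))‖ := by
    rw [norm_sub_rev (u h - v h)]
    exact norm_le_insert' _ _
  have h6 : ε / 2 * D * h ≤ ε / 2 * (2 * ‖u h - v h‖) * h := by gcongr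
  linarith

theorem eventually_injOn_euler (hf : ContDiff ℝ 1 f) (hK : Convex ℝ K) (hKc : IsCompact K) :
    ∀ᶠ h in 𝓝[>] (0 : ℝ), InjOn (fun x => x + h • f x) K := by
  obtain ⟨L, hL⟩ := hKc.exists_bound_of_continuousOn
    (hf.continuous_fderiv (by norm_num)).continuousOn
  have hlim : Tendsto (fun h : ℝ => h * L) (𝓝[>] 0) (𝓝 0) := by
    simpa using ((continuous_mul_const L).tendsto 0).mono_left nhdsWithin_le_nhds
  filter_upwards [self_mem_nhdsWithin, hlim.eventually_lt_const one_pos] with h hh hL1 x hx y hy hxy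
  have h1 := hK.norm_image_sub_le_of_norm_fderiv_le
    (fun p _ => (hf.differentiable (by norm_num)).differentiableAt) hL hx hy
  have h2 : x - y = h • (f y - f x) := by
    rw [smul_sub, sub_eq_sub_iff_add_eq_add]
    simpa [add_comm] using hxy
  have h3 : ‖y - x‖ ≤ h * L * ‖y - x‖ := by
    calc ‖y - x‖ = h * ‖f y - f x‖ := by
          rw [norm_sub_rev, h2, norm_smul, Real.norm_of_nonneg (le_of_lt hh)]
      _ ≤ h * (L * ‖y - x‖) := by gcongr; exact le_of_lt hh
      _ = h * L * ‖y - x‖ := by ring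
  have h4 : ‖y - x‖ = 0 := by nlinarith [norm_nonneg (y - x)]
  exact (sub_eq_zero.1 (norm_eq_zero.1 h4)).symm

end Flow

section Measure

variable {E : Type*} [NormedAddCommGroup E] [NormedSpace ℝ E] [FiniteDimensional ℝ E]
  [MeasurableSpace E] [BorelSpace E] (μ : Measure E) [μ.IsAddHaarMeasure]

theorem LipschitzOnWith.addHaar_image_le {C : ℝ≥0} {g : E → E} {s : Set E}
    (hg : LipschitzOnWith C g s) : μ (g '' s) ≤ (C : ℝ≥0∞) ^ Module.finrank ℝ E * μ s := by
  rw [Measure.isAddLeftInvariant_eq_smul μ (Measure.hausdorffMeasure (Module.finrank ℝ E : ℝ))]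
  have := hg.hausdorffMeasure_image_le (Nat.cast_nonneg (Module.finrank ℝ E))
  rw [ENNReal.rpow_natCast] at this
  simp only [Measure.smul_apply, ENNReal.smul_def, smul_eq_mul]
  calc _ ≤ _ := mul_le_mul_right this _
    _ = _ := by ring

/-- A map whose differences are dominated by those of `φ` enlarges volume at most as `φ` does. -/
theorem addHaar_image_le_of_norm_sub_le {C : ℝ≥0} {g φ : E → E} {s : Set E}
    (h : ∀ x ∈ s, ∀ y ∈ s, ‖g x - g y‖ ≤ C * ‖φ x - φ y‖) :
    μ (g '' s) ≤ (C : ℝ≥0∞) ^ Module.finrank ℝ E * μ (φ '' s) := by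
  choose! ψ hψs hψ using fun z (hz : z ∈ φ '' s) => hz
  have hψg : LipschitzOnWith C (g ∘ ψ) (φ '' s) := by
    refine LipschitzOnWith.of_dist_le_mul fun z hz w hw => ?_
    simpa [dist_eq_norm, hψ z hz, hψ w hw] using h _ (hψs z hz) _ (hψs w hw)
  have himage : (g ∘ ψ) '' (φ '' s) = g '' s := by
    rw [← image_comp]
    refine image_congr fun x hx => ?_
    have hx' := mem_image_of_mem φ hx
    have := h _ (hψs _ hx') x hx
    rw [hψ _ hx', sub_self, norm_zero, mul_zero] at this
    exact sub_eq_zero.1 (norm_le_zero_iff.1 this)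
  simpa only [himage] using hψg.addHaar_image_le μ

/-- An Euler step of a vector field with divergence at least `d > d'` expands volume by a factor at
least `1 + h d'`. -/
theorem eventually_mul_addHaar_le_addHaar_image_euler {f : E → E} (hf : ContDiff ℝ 1 f)
    {d d' : ℝ} (hd : d' < d) {K : Set E} (hK : Convex ℝ K) (hKc : IsCompact K)
    (hdiv : ∀ x ∈ K, d ≤ LinearMap.trace ℝ E (fderiv ℝ f x)) {s : Set E} (hs : MeasurableSet s)
    (hsK : s ⊆ K) :
    ∀ᶠ h in 𝓝[>] (0 : ℝ),
      ENNReal.ofReal (1 + h * d') * μ s ≤ μ ((fun x => x + h • f x) '' s) := by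
  obtain ⟨L, hL⟩ := hKc.exists_bound_of_continuousOn
    (hf.continuous_fderiv (by norm_num)).continuousOn
  filter_upwards [ContinuousLinearMap.eventually_one_add_mul_le_det_one_add_smul (E := E) L hd,
    eventually_injOn_euler hf hK hKc] with h hdet hinj
  have hderiv : ∀ x ∈ s, HasFDerivWithinAt (fun x => x + h • f x)
      (1 + h • fderiv ℝ f x) s x := fun x _ =>
    ((hasFDerivAt_id x).add
      ((hf.differentiable (by norm_num) x).hasFDerivAt.const_smul h)).hasFDerivWithinAt
  rw [← lintegral_abs_det_fderiv_eq_addHaar_image μ hs hderiv (hinj.mono hsK),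
    ← setLIntegral_const]
  refine setLIntegral_mono' hs fun x hx => ENNReal.ofReal_le_ofReal ?_
  exact (hdet _ (hL x (hsK hx)) (hdiv x (hsK hx))).trans (le_abs_self _)

end Measure

theorem trace_jacobian {n : ℕ} (f : EuclideanSpace ℝ (Fin n) → EuclideanSpace ℝ (Fin n))
    (x : EuclideanSpace ℝ (Fin n)) :
    (jacobian f x).trace = LinearMap.trace ℝ (EuclideanSpace ℝ (Fin n)) (fderiv ℝ f x) := by
  rw [LinearMap.trace_eq_sum_inner _ (EuclideanSpace.basisFun (Fin n) ℝ)]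
  simp [Matrix.trace, jacobian, EuclideanSpace.inner_single_left]

/-- if `f` is `C¹` with `div f(x) = trace Df(x) ≥ d > 0` everywhere, then any
bounded measurable positively invariant set `B` (carrying a semiflow `φ` of solutions of
`u' = f(u)`) has Lebesgue measure zero. -/
theorem volume_eq_zero_of_pos_div {n : ℕ}
    (f : EuclideanSpace ℝ (Fin n) → EuclideanSpace ℝ (Fin n))
    (hf : ContDiff ℝ 1 f) (d : ℝ) (hd : 0 < d)
    (hdiv : ∀ x : EuclideanSpace ℝ (Fin n), d ≤ (jacobian f x).trace)
    (B : Set (EuclideanSpace ℝ (Fin n)))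
    (hBmeas : MeasurableSet B) (hBbdd : Bornology.IsBounded B)
    (φ : ℝ → EuclideanSpace ℝ (Fin n) → EuclideanSpace ℝ (Fin n))
    (hφ0 : ∀ x ∈ B, φ 0 x = x)
    (hφd : ∀ x ∈ B, ∀ t : ℝ, 0 ≤ t →
      HasDerivWithinAt (fun s => φ s x) (f (φ t x)) (Set.Ici 0) t)
    (hφinv : ∀ t : ℝ, 0 ≤ t → φ t '' B ⊆ B) :
    MeasureTheory.volume B = 0 := by
  obtain ⟨R, hR⟩ := hBbdd.subset_closedBall 0
  have hK : Convex ℝ (closedBall (0 : EuclideanSpace ℝ (Fin n)) R) := convex_closedBall 0 R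
  have hKc : IsCompact (closedBall (0 : EuclideanSpace ℝ (Fin n)) R) := isCompact_closedBall 0 R
  have hmem : ∀ x ∈ B, ∀ t : ℝ, 0 ≤ t → φ t x ∈ closedBall (0 : EuclideanSpace ℝ (Fin n)) R :=
    fun x hx t ht =>
    hR (hφinv t ht (mem_image_of_mem _ hx))
  set ε := d / (8 * (n + 1)) with hε
  have hεpos : 0 < ε := by positivity
  have hnε : n * ε ≤ d / 8 := by
    rw [hε, mul_div_assoc', div_le_div_iff₀ (by positivity) (by positivity)]
    nlinarith
  have hsmall : ∀ᶠ h in 𝓝[>] (0 : ℝ), h < 1 / d :=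
    nhdsWithin_le_nhds (Iio_mem_nhds (by positivity))
  obtain ⟨h, hflow, hvol, hhd, hh⟩ := ((eventually_norm_euler_sub_le hf hK hKc hεpos).and
    ((eventually_mul_addHaar_le_addHaar_image_euler volume hf (half_lt_self hd) hK hKc
      (fun x _ => (hdiv x).trans_eq (trace_jacobian f x)) hBmeas hR).and
      (hsmall.and self_mem_nhdsWithin))).exists
  replace hh : 0 < h := hh
  have hC : 0 ≤ 1 + ε * h := by positivity
  have hle := addHaar_image_le_of_norm_sub_le volume (C := ⟨1 + ε * h, hC⟩)
    (g := fun x => x + h • f x) (φ := φ h) (s := B) fun x hx y hy => by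
      have hsol (z) (hz : z ∈ B) : ∀ t ∈ Icc 0 h,
          φ t z ∈ closedBall (0 : EuclideanSpace ℝ (Fin n)) R ∧
          HasDerivWithinAt (fun s => φ s z) (f (φ t z)) (Ici 0) t :=
        fun t ht => ⟨hmem z hz t ht.1, hφd z hz t ht.1⟩
      have hxy := hflow _ _ (hsol x hx) (hsol y hy)
      rw [hφ0 x hx, hφ0 y hy] at hxy
      exact hxy
  have hfactor : (1 + ε * h) ^ n < 1 + h * (d / 2) := by
    have hhd' : h * d < 1 := (lt_div_iff₀ hd).1 hhd
    have hy : n * (ε * h) ≤ h * d / 8 := by nlinarith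
    have hy0 : 0 ≤ n * (ε * h) := by positivity
    have hexp := Real.abs_exp_sub_one_le (x := n * (ε * h)) (by rw [abs_of_nonneg hy0]; linarith)
    rw [abs_of_nonneg hy0] at hexp
    have hpow : (1 + ε * h) ^ n ≤ Real.exp (n * (ε * h)) := by
      rw [Real.exp_nat_mul]
      gcongr
      linarith [Real.add_one_le_exp (ε * h)]
    have := mul_pos hh hd
    linarith [le_abs_self (Real.exp (n * (ε * h)) - 1)]
  have hchain : ENNReal.ofReal (1 + h * (d / 2)) * volume B ≤
      ENNReal.ofReal ((1 + ε * h) ^ n) * volume B := by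
    refine hvol.trans (hle.trans ?_)
    rw [finrank_euclideanSpace_fin, ENNReal.ofReal_pow hC, ENNReal.ofReal_eq_coe_nnreal hC]
    exact mul_le_mul_right (measure_mono (hφinv h hh.le)) _
  by_contra hne
  have := (ENNReal.mul_le_mul_iff_left hne hBbdd.measure_lt_top.ne).1 hchain
  exact this.not_gt ((ENNReal.ofReal_lt_ofReal_iff (by positivity)).2 hfactor)
end
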